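/- arXiv:2309.14275 — 3 statements merged into one kernel-verified Lean document; each statement's English description precedes it below -/
import Mathlib

section
/- For every constant C ∈ ℕ there exists c > 0 such that the following holds. Let m ≥ 1, let S₀,…,S_m be disjoint subsets of ℤ² with #S_j ≤ 2^j, let λ₀,…,λ_m ≥ 0, let f = Σ_{j=0}^m λ_j 2^{−j/2} χ_{S_j}, and let τ ≥ 0 be an integer. Then Σ_{Q ∈ 𝒬^τ} f(Q) ≤ c ( max_{α,β ∈ {1,2,3}} Σ_{Q=(ξ₁,ξ₂,ξ₃,ξ₄) ∈ 𝒬⁰_{α,β}, gcd(ξ₁−ξ₄) ∣ τ} f(Q) + (Σ_{ξ∈ℤ²} f(ξ)²)² ). -/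
open scoped BigOperators

noncomputable section

/-- Points of the integer lattice `ℤ²`. -/
abbrev Pt := ℤ × ℤ

/-- A quadruple of lattice points, viewed as a function on `Fin 4`
(indices taken cyclically). -/
abbrev Quad := Fin 4 → Pt

/-- The embedding `ℤ² ↪ ℝ²`. -/
def emb (ξ : Pt) : ℝ × ℝ := ((ξ.1 : ℝ), (ξ.2 : ℝ))

/-- An affine line in the plane `ℝ²`. -/
def IsLine (ℓ : Set (ℝ × ℝ)) : Prop :=
  ∃ p v : ℝ × ℝ, v ≠ 0 ∧ ℓ = {x | ∃ t : ℝ, x = p + t • v}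

/-- The line through two lattice points `p ≠ q` (a degenerate point if `p = q`). -/
def lineThrough (p q : Pt) : Set (ℝ × ℝ) :=
  {x | ∃ t : ℝ, x = emb p + t • (emb q - emb p)}

/-- The number of points of a finite set `T ⊂ ℤ²` on a set `ℓ ⊂ ℝ²`,
i.e. `#(ℓ ∩ T)`. -/
def lineCount (ℓ : Set (ℝ × ℝ)) (T : Finset Pt) : ℕ :=
  (ℓ ∩ (emb '' (T : Set Pt))).ncard

/-- `Q = (ξ₁,ξ₂,ξ₃,ξ₄)` is a parallelogram: `ξ₁ + ξ₃ = ξ₂ + ξ₄`. -/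
def IsPara (Q : Quad) : Prop := Q 0 + Q 2 = Q 1 + Q 3

/-- The dot product `(ξ₁ − ξ₂)·(ξ₁ − ξ₄)`. -/
def dotQ (Q : Quad) : ℤ :=
  ((Q 0).1 - (Q 1).1) * ((Q 0).1 - (Q 3).1) + ((Q 0).2 - (Q 1).2) * ((Q 0).2 - (Q 3).2)

/-- `τ_Q = ||ξ₁|² − |ξ₂|² + |ξ₃|² − |ξ₄|²| = 2|(ξ₁−ξ₂)·(ξ₁−ξ₄)|`. -/
def tauQ (Q : Quad) : ℤ := 2 * |dotQ Q|

/-- `Q` is a rectangle: a parallelogram with `τ_Q = 0`. Membership in `𝒬⁰`. -/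
def IsRect (Q : Quad) : Prop := IsPara Q ∧ dotQ Q = 0

/-- `f(Q) = f(ξ₁)f(ξ₂)f(ξ₃)f(ξ₄)`. -/
def fQ (f : Pt → ℝ) (Q : Quad) : ℝ := ∏ k : Fin 4, f (Q k)

/-- The weight `f = ∑_{j=0}^m λ_j 2^{−j/2} χ_{S_j}`. -/
def fWt (S : ℕ → Finset Pt) (lam : ℕ → ℝ) (m : ℕ) (ξ : Pt) : ℝ :=
  ∑ j ∈ Finset.range (m + 1), if ξ ∈ S j then lam j * (2 : ℝ) ^ (-(j : ℝ) / 2) else 0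

/-- `gcd((a,b)) = gcd(|a|,|b|)` for `(a,b) ∈ ℤ²`. -/
def gcdP (ξ : Pt) : ℕ := Int.gcd ξ.1 ξ.2

/-- `max{#(ℓ(ξ,η₁) ∩ S_j), #(ℓ(ξ,η₂) ∩ S_j)}`, where `η₁, η₂` are the two
neighboring vertices of `ξ` in a rectangle. -/
def crossMax (S : ℕ → Finset Pt) (j : ℕ) (ξ η₁ η₂ : Pt) : ℕ :=
  max (lineCount (lineThrough ξ η₁) (S j)) (lineCount (lineThrough ξ η₂) (S j))

/-- `ξ` lies in some `S_j`, `j ≤ m`, and is a vertex of type `α ∈ {1,2,3}`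
relative to its neighbors `η₁, η₂`: with `a := log₂ crossMax`, type 1 means
`a ≥ j/2 + C` (i.e. `crossMax ≥ 2^{j/2+C}`), type 2 means `1 ≤ a < j/2 + C`
(i.e. `2 ≤ crossMax < 2^{j/2+C}`), and type 3 means `a = 0` (`crossMax = 1`). -/
def VertexType (S : ℕ → Finset Pt) (C m : ℕ) (α : ℕ) (ξ η₁ η₂ : Pt) : Prop :=
  ∃ j ≤ m, ξ ∈ S j ∧
    ((α = 1 ∧ (2 : ℝ) ^ ((j : ℝ) / 2 + (C : ℝ)) ≤ (crossMax S j ξ η₁ η₂ : ℝ)) ∨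
     (α = 2 ∧ 2 ≤ crossMax S j ξ η₁ η₂ ∧
        (crossMax S j ξ η₁ η₂ : ℝ) < (2 : ℝ) ^ ((j : ℝ) / 2 + (C : ℝ))) ∨
     (α = 3 ∧ crossMax S j ξ η₁ η₂ = 1))

/-- The set `𝒬⁰_{α,β}`: rectangles with four distinct vertices, all in
`∪_{j=0}^m S_j`, with `ξ₁, ξ₂` of type `α` and `ξ₃, ξ₄` of type `β`. -/
def QZeroAB (S : ℕ → Finset Pt) (C m : ℕ) (α β : ℕ) : Set Quad :=
  {Q | IsRect Q ∧ Function.Injective Q ∧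
    VertexType S C m α (Q 0) (Q 1) (Q 3) ∧
    VertexType S C m α (Q 1) (Q 2) (Q 0) ∧
    VertexType S C m β (Q 2) (Q 3) (Q 1) ∧
    VertexType S C m β (Q 3) (Q 0) (Q 2)}

/-- The set `𝒬⁰(j⃗, a⃗)`: rectangles with distinct vertices `ξ_k ∈ S_{j_k}` such
that for each `k` (cyclically), `2^{a_k} ≤ max{#(ℓ(ξ_k,ξ_{k+1}) ∩ S_{j_k}),
#(ℓ(ξ_k,ξ_{k−1}) ∩ S_{j_k})} < 2^{a_k+1}`. -/
def QZeroJA (S : ℕ → Finset Pt) (j a : Fin 4 → ℕ) : Set Quad :=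
  {Q | IsRect Q ∧ Function.Injective Q ∧ (∀ k, Q k ∈ S (j k)) ∧
    ∀ k : Fin 4,
      2 ^ (a k) ≤ max (lineCount (lineThrough (Q k) (Q (k + 1))) (S (j k)))
          (lineCount (lineThrough (Q k) (Q (k - 1))) (S (j k))) ∧
        max (lineCount (lineThrough (Q k) (Q (k + 1))) (S (j k)))
          (lineCount (lineThrough (Q k) (Q (k - 1))) (S (j k))) < 2 ^ (a k + 1)}


/-- A Schur-type bound: if `R` is a symmetric relation under which every label has at most `N`
related labels, then a bilinear sum over `R`-related labels is at most `N` times the sum over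
equal labels. -/
theorem sum_rel_le_card_mul_sum_eq {ι L : Type*} [DecidableEq L] (E : Finset ι)
    (g : ι → ℝ) (d : ι → L) (R : L → L → Prop) [DecidableRel R] (hR : ∀ a b, R a b → R b a) (N : ℕ)
    (hN : ∀ (a : L) (s : Finset L), (s.filter (R a)).card ≤ N) :
    ∑ p ∈ E, ∑ q ∈ E, (if R (d p) (d q) then g p * g q else 0) ≤
      N * ∑ p ∈ E, ∑ q ∈ E, (if d p = d q then g p * g q else 0) := by
  set s := E.image d with hs
  set G : L → ℝ := fun a => ∑ p ∈ E with d p = a, g p with hG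
  have fiber : ∀ (P : L → L → Prop) [DecidableRel P],
      ∑ p ∈ E, ∑ q ∈ E, (if P (d p) (d q) then g p * g q else 0) =
        ∑ a ∈ s, ∑ b ∈ s, if P a b then G a * G b else 0 := by
    intro P _
    have hmap : ∀ p ∈ E, d p ∈ s := fun p hp => Finset.mem_image_of_mem d hp
    rw [← Finset.sum_fiberwise_of_maps_to hmap]
    refine Finset.sum_congr rfl fun a _ => ?_
    have h1 : ∀ p ∈ E.filter (fun p => d p = a),
        ∑ q ∈ E, (if P (d p) (d q) then g p * g q else 0) =
          ∑ b ∈ s, if P a b then g p * G b else 0 := by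
      intro p hp
      have hpa := (Finset.mem_filter.1 hp).2
      rw [← Finset.sum_fiberwise_of_maps_to hmap]
      refine Finset.sum_congr rfl fun b _ => ?_
      rw [hG]
      split_ifs with h
      · rw [Finset.mul_sum]
        refine Finset.sum_congr rfl fun q hq => ?_
        rw [hpa, (Finset.mem_filter.1 hq).2, if_pos h]
      · refine Finset.sum_eq_zero fun q hq => ?_
        rw [hpa, (Finset.mem_filter.1 hq).2, if_neg h]
    rw [Finset.sum_congr rfl h1, Finset.sum_comm]
    refine Finset.sum_congr rfl fun b _ => ?_
    split_ifs
    · rw [hG, Finset.sum_mul]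
    · simp
  rw [fiber R, fiber (fun a b => a = b)]
  have hdiag : ∑ a ∈ s, ∑ b ∈ s, (if a = b then G a * G b else 0) = ∑ a ∈ s, G a ^ 2 := by
    refine Finset.sum_congr rfl fun a ha => ?_
    rw [Finset.sum_ite_eq, if_pos ha, sq]
  rw [hdiag]
  have hhalf : ∑ a ∈ s, ∑ b ∈ s, (if R a b then G a ^ 2 else 0) ≤ N * ∑ a ∈ s, G a ^ 2 := by
    rw [Finset.mul_sum]
    refine Finset.sum_le_sum fun a _ => ?_
    rw [← Finset.sum_filter, Finset.sum_const, nsmul_eq_mul]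
    exact mul_le_mul_of_nonneg_right (by exact_mod_cast hN a s) (sq_nonneg _)
  have hswap : ∑ a ∈ s, ∑ b ∈ s, (if R a b then G b ^ 2 else 0) =
      ∑ a ∈ s, ∑ b ∈ s, (if R a b then G a ^ 2 else 0) := by
    rw [Finset.sum_comm]
    refine Finset.sum_congr rfl fun a _ => Finset.sum_congr rfl fun b _ => ?_
    simp only [show R b a ↔ R a b from ⟨hR _ _, hR _ _⟩]
  have hamgm : ∑ a ∈ s, ∑ b ∈ s, (if R a b then G a * G b else 0) ≤
      ∑ a ∈ s, ∑ b ∈ s, ((if R a b then G a ^ 2 else 0) + (if R a b then G b ^ 2 else 0)) / 2 := by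
    refine Finset.sum_le_sum fun a _ => Finset.sum_le_sum fun b _ => ?_
    split_ifs
    · nlinarith [sq_nonneg (G a - G b)]
    · simp
  simp only [← Finset.sum_div, Finset.sum_add_distrib] at hamgm
  linarith

/-- The dot product on `ℤ²`. -/
def dotP (u v : Pt) : ℤ := u.1 * v.1 + u.2 * v.2

/-- Rotation of `ℤ²` by a right angle. -/
def perp (v : Pt) : Pt := (-v.2, v.1)

theorem dotP_self_eq_zero {v : Pt} (h : dotP v v = 0) : v = 0 := by
  unfold dotP at h
  ext
  · show v.1 = 0
    nlinarith [mul_self_nonneg v.1, mul_self_nonneg v.2]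
  · show v.2 = 0
    nlinarith [mul_self_nonneg v.1, mul_self_nonneg v.2]

theorem lineThrough_subset_of_smul {p q q' : Pt} {c : ℝ} (h : emb q - emb p = c • (emb q' - emb p)) :
    lineThrough p q ⊆ lineThrough p q' := by
  rintro x ⟨t, rfl⟩
  exact ⟨t * c, by rw [h, smul_smul]⟩

theorem lineThrough_subset_of_cross_eq_zero {p q q' : Pt} (hq' : q' ≠ p)
    (h : (q.1 - p.1) * (q'.2 - p.2) = (q.2 - p.2) * (q'.1 - p.1)) :
    lineThrough p q ⊆ lineThrough p q' := by
  have hR : ((q.1 : ℝ) - p.1) * (q'.2 - p.2) = (q.2 - p.2) * (q'.1 - p.1) := by exact_mod_cast h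
  by_cases h1 : q'.1 = p.1
  · have h2 : q'.2 ≠ p.2 := fun h2 => hq' (Prod.ext h1 h2)
    have h2R : (q'.2 : ℝ) - p.2 ≠ 0 := sub_ne_zero.2 (by exact_mod_cast h2)
    refine lineThrough_subset_of_smul (c := (q.2 - p.2) / (q'.2 - p.2)) ?_
    ext
    · simp only [emb, Prod.fst_sub, Prod.smul_fst, smul_eq_mul]
      field_simp
      linarith
    · simp only [emb, Prod.snd_sub, Prod.smul_snd, smul_eq_mul]
      field_simp
  · have h1R : (q'.1 : ℝ) - p.1 ≠ 0 := sub_ne_zero.2 (by exact_mod_cast h1)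
    refine lineThrough_subset_of_smul (c := (q.1 - p.1) / (q'.1 - p.1)) ?_
    ext
    · simp only [emb, Prod.fst_sub, Prod.smul_fst, smul_eq_mul]
      field_simp
    · simp only [emb, Prod.snd_sub, Prod.smul_snd, smul_eq_mul]
      field_simp
      linarith

theorem lineThrough_eq_of_cross_eq_zero {p q q' : Pt} (hq : q ≠ p) (hq' : q' ≠ p)
    (h : (q.1 - p.1) * (q'.2 - p.2) = (q.2 - p.2) * (q'.1 - p.1)) :
    lineThrough p q = lineThrough p q' :=
  (lineThrough_subset_of_cross_eq_zero hq' h).antisymm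
    (lineThrough_subset_of_cross_eq_zero hq (by linarith))

theorem VertexType.congr {S : ℕ → Finset Pt} {C m α : ℕ} {ξ η₁ η₂ ζ₁ ζ₂ : Pt}
    (h : VertexType S C m α ξ η₁ η₂) (h₁ : lineThrough ξ η₁ = lineThrough ξ ζ₁)
    (h₂ : lineThrough ξ η₂ = lineThrough ξ ζ₂) : VertexType S C m α ξ ζ₁ ζ₂ := by
  simpa only [VertexType, crossMax, h₁, h₂] using h

theorem VertexType.swap {S : ℕ → Finset Pt} {C m α : ℕ} {ξ η₁ η₂ : Pt}
    (h : VertexType S C m α ξ η₁ η₂) : VertexType S C m α ξ η₂ η₁ := by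
  have hc : ∀ j, crossMax S j ξ η₂ η₁ = crossMax S j ξ η₁ η₂ := fun j => max_comm _ _
  simpa only [VertexType, hc] using h

theorem exists_vertexType (S : ℕ → Finset Pt) (C m : ℕ) {j : ℕ} (hj : j ≤ m) {ξ : Pt}
    (hξ : ξ ∈ S j) (η₁ η₂ : Pt) : ∃ i : Fin 3, VertexType S C m (i + 1) ξ η₁ η₂ := by
  have hpos : 1 ≤ crossMax S j ξ η₁ η₂ := by
    refine le_max_of_le_left ?_
    refine Nat.one_le_iff_ne_zero.2 (Set.ncard_ne_zero_of_mem (a := emb ξ) ?_ ?_)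
    · exact ⟨⟨0, by simp⟩, ⟨ξ, hξ, rfl⟩⟩
    · exact ((S j).finite_toSet.image emb).subset Set.inter_subset_right
  by_cases h1 : (2 : ℝ) ^ ((j : ℝ) / 2 + (C : ℝ)) ≤ (crossMax S j ξ η₁ η₂ : ℝ)
  · exact ⟨0, j, hj, hξ, Or.inl ⟨rfl, h1⟩⟩
  · rcases hpos.eq_or_lt with h | h
    · exact ⟨2, j, hj, hξ, Or.inr (Or.inr ⟨rfl, h.symm⟩)⟩
    · exact ⟨1, j, hj, hξ, Or.inr (Or.inl ⟨rfl, h, not_le.1 h1⟩)⟩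

/-- Quadruples of points, regarded as pairs of opposite edges `(ξ₁, ξ₄)` and `(ξ₂, ξ₃)`. -/
def edgesEquivQuad : (Pt × Pt) × (Pt × Pt) ≃ Quad where
  toFun e := ![e.1.1, e.2.1, e.2.2, e.1.2]
  invFun Q := ((Q 0, Q 3), (Q 1, Q 2))
  left_inv _ := rfl
  right_inv Q := by ext k : 1; fin_cases k <;> rfl

theorem tsum_indicator_fQ (f : Pt → ℝ) (A : Finset Pt) (hf : ∀ ξ ∉ A, f ξ = 0) (X : Set Quad)
    [DecidablePred (· ∈ X)] :
    ∑' Q : Quad, X.indicator (fQ f) Q =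
      ∑ p ∈ A ×ˢ A, ∑ q ∈ A ×ˢ A,
        if edgesEquivQuad (p, q) ∈ X then (f p.1 * f p.2) * (f q.1 * f q.2) else 0 := by
  have hval : ∀ e, fQ f (edgesEquivQuad e) = (f e.1.1 * f e.1.2) * (f e.2.1 * f e.2.2) := by
    intro e
    rw [fQ, Fin.prod_univ_four]
    show f e.1.1 * f e.2.1 * f e.2.2 * f e.1.2 = _
    ring
  rw [← edgesEquivQuad.tsum_eq, tsum_eq_sum (s := (A ×ˢ A) ×ˢ (A ×ˢ A)), Finset.sum_product]
  · refine Finset.sum_congr rfl fun p _ => Finset.sum_congr rfl fun q _ => ?_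
    rw [Set.indicator_apply, hval]
  · intro e he
    rw [Set.indicator_apply, hval]
    split_ifs
    · by_contra hne
      refine he ?_
      simp only [mul_ne_zero_iff] at hne
      simp only [Finset.mem_product]
      exact ⟨⟨by_contra fun h => hne.1.1 (hf _ h), by_contra fun h => hne.1.2 (hf _ h)⟩,
        ⟨by_contra fun h => hne.2.1 (hf _ h), by_contra fun h => hne.2.2 (hf _ h)⟩⟩
    · rfl

theorem isPara_edgesEquivQuad (p q : Pt × Pt) :
    IsPara (edgesEquivQuad (p, q)) ↔ p.1 - p.2 = q.1 - q.2 := by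
  show p.1 + q.2 = q.1 + p.2 ↔ _
  rw [sub_eq_sub_iff_add_eq_add]

theorem dotQ_edgesEquivQuad {p q : Pt × Pt} (h : p.1 - p.2 = q.1 - q.2) :
    dotQ (edgesEquivQuad (p, q)) = dotP p.1 (p.1 - p.2) - dotP q.1 (q.1 - q.2) := by
  rw [← h]
  show (p.1.1 - q.1.1) * (p.1.1 - p.2.1) + (p.1.2 - q.1.2) * (p.1.2 - p.2.2) = _
  simp only [dotP, Prod.fst_sub, Prod.snd_sub]
  ring

theorem gcdP_dvd_of_tauQ_eq {p q : Pt × Pt} {τ : ℕ}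
    (h : tauQ (edgesEquivQuad (p, q)) = τ) : gcdP (p.1 - p.2) ∣ τ := by
  rw [← Int.natCast_dvd_natCast, ← h]
  refine Dvd.dvd.mul_left ((dvd_abs _ _).2 ?_) _
  exact dvd_add (Dvd.dvd.mul_left (Int.gcd_dvd_left ..) _) (Dvd.dvd.mul_left (Int.gcd_dvd_right ..) _)

theorem edgesEquivQuad_injective {p q : Pt × Pt} (hpq : p ≠ q) (hv : p.1 - p.2 ≠ 0)
    (hd : p.1 - p.2 = q.1 - q.2) (hs : dotP p.1 (p.1 - p.2) = dotP q.1 (q.1 - q.2)) :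
    Function.Injective (edgesEquivQuad (p, q)) := by
  obtain ⟨x, x'⟩ := p
  obtain ⟨y, y'⟩ := q
  simp only at hv hd hs
  have hxx : x ≠ x' := sub_ne_zero.1 hv
  have hyy : y ≠ y' := sub_ne_zero.1 (hd ▸ hv)
  have hxy : x ≠ y := by
    rintro rfl
    exact hpq (by rw [sub_right_inj.1 hd])
  have hxy' : x' ≠ y' := by
    rintro rfl
    exact hpq (by rw [sub_left_inj.1 hd])
  have hdiag : x ≠ y' := by
    rintro rfl
    refine hv (dotP_self_eq_zero ?_)
    have e : y = x + (x - x') := by rw [hd]; abel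
    rw [← hd, e] at hs
    simp only [dotP, Prod.fst_add, Prod.snd_add, Prod.fst_sub, Prod.snd_sub] at hs ⊢
    linarith
  have hdiag' : y ≠ x' := by
    rintro rfl
    refine hv (dotP_self_eq_zero ?_)
    rw [← hd] at hs
    simp only [dotP, Prod.fst_sub, Prod.snd_sub] at hs ⊢
    linarith
  show Function.Injective ![x, y, y', x']
  intro i j hij
  fin_cases i <;> fin_cases j <;> simp_all [eq_comm]

/-- The type of a vertex of a nondegenerate rectangle depends only on the vertex and on the
direction `v` of one of the sides. -/
theorem VertexType.of_side {S : ℕ → Finset Pt} {C m α : ℕ} {ξ η ζ v : Pt} (hv : v ≠ 0)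
    (h : VertexType S C m α ξ (ξ + v) (ξ + perp v)) (hη : η = ξ + v ∨ η = ξ - v)
    (hζ : ζ ≠ ξ) (hort : dotP (ζ - ξ) v = 0) : VertexType S C m α ξ η ζ := by
  have hperp : perp v ≠ 0 := by
    intro h0
    simp only [perp, Prod.mk_eq_zero, neg_eq_zero] at h0
    exact hv (Prod.ext h0.2 h0.1)
  refine h.congr (lineThrough_eq_of_cross_eq_zero (by simpa using hv) ?_ ?_)
    (lineThrough_eq_of_cross_eq_zero (by simpa using hperp) hζ ?_)
  · rcases hη with rfl | rfl <;> simpa using hv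
  · rcases hη with rfl | rfl <;> simp <;> ring
  · simp only [dotP, Prod.fst_sub, Prod.snd_sub] at hort
    simp only [perp, Prod.fst_add, Prod.snd_add]
    linarith

theorem edgesEquivQuad_mem_QZeroAB {S : ℕ → Finset Pt} {C m α β : ℕ} {p q : Pt × Pt}
    (hpq : p ≠ q) (hv : p.1 - p.2 ≠ 0)
    (hd : p.1 - p.2 = q.1 - q.2) (hs : dotP p.1 (p.1 - p.2) = dotP q.1 (q.1 - q.2))
    (hp₁ : VertexType S C m α p.1 (p.1 + (p.1 - p.2)) (p.1 + perp (p.1 - p.2)))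
    (hp₂ : VertexType S C m β p.2 (p.2 + (p.1 - p.2)) (p.2 + perp (p.1 - p.2)))
    (hq₁ : VertexType S C m α q.1 (q.1 + (q.1 - q.2)) (q.1 + perp (q.1 - q.2)))
    (hq₂ : VertexType S C m β q.2 (q.2 + (q.1 - q.2)) (q.2 + perp (q.1 - q.2))) :
    edgesEquivQuad (p, q) ∈ QZeroAB S C m α β := by
  have hinj := edgesEquivQuad_injective hpq hv hd hs
  have h01 : p.1 ≠ q.1 := hinj.ne (show (0 : Fin 4) ≠ 1 by decide)
  have h32 : p.2 ≠ q.2 := hinj.ne (show (3 : Fin 4) ≠ 2 by decide)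
  refine ⟨⟨(isPara_edgesEquivQuad p q).2 hd, ?_⟩, hinj, ?_, ?_, ?_, ?_⟩
  · rw [dotQ_edgesEquivQuad hd, hs, sub_self]
  all_goals
    rw [← hd] at hs hq₁ hq₂
    have hd₁ := congrArg Prod.fst hd
    have hd₂ := congrArg Prod.snd hd
    simp only [Prod.fst_sub, Prod.snd_sub] at hd₁ hd₂
  · refine (VertexType.of_side hv hp₁ (Or.inr ?_) h01.symm ?_).swap
    · show p.2 = p.1 - _
      abel
    · simp only [dotP, Prod.fst_sub, Prod.snd_sub] at hs ⊢
      show (q.1.1 - p.1.1) * _ + (q.1.2 - p.1.2) * _ = 0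
      linarith
  · refine VertexType.of_side hv hq₁ (Or.inr ?_) h01 ?_
    · show q.2 = q.1 - _
      rw [hd]; abel
    · simp only [dotP, Prod.fst_sub, Prod.snd_sub] at hs ⊢
      show (p.1.1 - q.1.1) * _ + (p.1.2 - q.1.2) * _ = 0
      linarith
  · refine (VertexType.of_side hv hq₂ (Or.inl ?_) h32 ?_).swap
    · show q.1 = q.2 + _
      rw [hd]; abel
    · simp only [dotP, Prod.fst_sub, Prod.snd_sub] at hs ⊢
      show (p.2.1 - q.2.1) * _ + (p.2.2 - q.2.2) * _ = 0
      rw [show p.2.1 - q.2.1 = p.1.1 - q.1.1 by linarith,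
        show p.2.2 - q.2.2 = p.1.2 - q.1.2 by linarith]
      linarith
  · refine VertexType.of_side hv hp₂ (Or.inl ?_) h32.symm ?_
    · show p.1 = p.2 + _
      abel
    · simp only [dotP, Prod.fst_sub, Prod.snd_sub] at hs ⊢
      show (q.2.1 - p.2.1) * _ + (q.2.2 - p.2.2) * _ = 0
      rw [show q.2.1 - p.2.1 = q.1.1 - p.1.1 by linarith,
        show q.2.2 - p.2.2 = q.1.2 - p.1.2 by linarith]
      linarith

/-- Labels of edges: the side vector, its position, and the types of the two end points. Two
labels are related if they can occur as opposite edges of a parallelogram with `τ_Q = τ`. -/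
def LabelRel (τ : ℕ) (a b : (Pt × ℤ) × (Fin 3 × Fin 3)) : Prop :=
  a.1.1 = b.1.1 ∧ 2 * |a.1.2 - b.1.2| = τ

instance (τ : ℕ) : DecidableRel (LabelRel τ) := fun _ _ => inferInstanceAs (Decidable (_ ∧ _))

theorem LabelRel.symm {τ : ℕ} {a b : (Pt × ℤ) × (Fin 3 × Fin 3)} (h : LabelRel τ a b) :
    LabelRel τ b a :=
  ⟨h.1.symm, by rw [abs_sub_comm]; exact h.2⟩

theorem card_filter_labelRel_le (τ : ℕ) (a : (Pt × ℤ) × (Fin 3 × Fin 3))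
    (s : Finset ((Pt × ℤ) × (Fin 3 × Fin 3))) : (s.filter (LabelRel τ a)).card ≤ 18 := by
  have hsub : s.filter (LabelRel τ a) ⊆
      (({a.1.1} : Finset Pt) ×ˢ ({a.1.2 + τ / 2, a.1.2 - τ / 2} : Finset ℤ)) ×ˢ Finset.univ := by
    intro b hb
    obtain ⟨h1, h2⟩ := (Finset.mem_filter.1 hb).2
    simp only [Finset.mem_product, Finset.mem_singleton, Finset.mem_insert, Finset.mem_univ,
      and_true]
    refine ⟨h1.symm, ?_⟩
    rcases abs_cases (a.1.2 - b.1.2) with h | h <;> omega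
  refine (Finset.card_le_card hsub).trans ?_
  rw [Finset.card_product, Finset.card_product, Finset.card_singleton, one_mul]
  have h2 : ({a.1.2 + τ / 2, a.1.2 - τ / 2} : Finset ℤ).card ≤ 2 := Finset.card_le_two
  have h9 : (Finset.univ : Finset (Fin 3 × Fin 3)).card = 9 := rfl
  rw [h9]
  omega

/-- **Reduction estimate (3.4) of Lemma 3.2.** For every integer `τ ≥ 0`,
`Σ_{Q ∈ 𝒬^τ} f(Q) ≲ max_{α,β} Σ_{Q ∈ 𝒬⁰_{α,β}, gcd(ξ₁−ξ₄) ∣ τ} f(Q) + ‖f‖_{ℓ²}⁴`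
(the `max` over `α, β ∈ {1,2,3}` is expressed by existence of a maximizing pair). -/
theorem reduction_to_QZeroAB (C : ℕ) :
    ∃ c : ℝ, 0 < c ∧
      ∀ (m : ℕ) (S : ℕ → Finset Pt) (lam : ℕ → ℝ),
        1 ≤ m →
        (∀ i ≤ m, ∀ j ≤ m, i ≠ j → Disjoint (S i) (S j)) →
        (∀ j ≤ m, (S j).card ≤ 2 ^ j) →
        (∀ j ≤ m, 0 ≤ lam j) →
        ∀ τ : ℕ,
          ∃ α ∈ ({1, 2, 3} : Set ℕ), ∃ β ∈ ({1, 2, 3} : Set ℕ),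
            ∑' Q : Quad, Set.indicator {Q : Quad | IsPara Q ∧ tauQ Q = (τ : ℤ)}
                (fQ (fWt S lam m)) Q ≤
              c * ((∑' Q : Quad, Set.indicator
                      {Q : Quad | Q ∈ QZeroAB S C m α β ∧ gcdP (Q 0 - Q 3) ∣ τ}
                      (fQ (fWt S lam m)) Q) +
                    (∑' ξ : Pt, (fWt S lam m ξ) ^ 2) ^ 2) := by
  classical
  refine ⟨200, by norm_num, ?_⟩
  intro m S lam _ _ _ hlam τ
  set f := fWt S lam m with hfdef
  set A : Finset Pt := (Finset.range (m + 1)).biUnion S with hA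
  have hf0 : ∀ ξ, 0 ≤ f ξ := by
    intro ξ
    refine Finset.sum_nonneg fun j hj => ?_
    split_ifs
    · exact mul_nonneg (hlam j (by simpa [Nat.lt_succ_iff] using hj))
        (Real.rpow_nonneg (by norm_num) _)
    · exact le_rfl
  have hfA : ∀ ξ ∉ A, f ξ = 0 := by
    intro ξ hξ
    refine Finset.sum_eq_zero fun j hj => if_neg fun h => hξ ?_
    exact Finset.mem_biUnion.2 ⟨j, hj, h⟩
  have htype : ∀ ξ v : Pt, ∃ i : Fin 3,
      ξ ∈ A → VertexType S C m (i + 1) ξ (ξ + v) (ξ + perp v) := by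
    intro ξ v
    by_cases hξ : ξ ∈ A
    · obtain ⟨j, hj, hξj⟩ := Finset.mem_biUnion.1 hξ
      obtain ⟨i, hi⟩ := exists_vertexType S C m (Nat.lt_succ_iff.1 (Finset.mem_range.1 hj)) hξj
        (ξ + v) (ξ + perp v)
      exact ⟨i, fun _ => hi⟩
    · exact ⟨0, fun h => absurd h hξ⟩
  choose T hT using htype
  set N : ℝ := ∑' ξ : Pt, f ξ ^ 2 with hN
  have hNsum : N = ∑ ξ ∈ A, f ξ ^ 2 :=
    tsum_eq_sum fun ξ hξ => by rw [hfA ξ hξ]; norm_num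
  set E := A ×ˢ A with hE
  set g : Pt × Pt → ℝ := fun p => f p.1 * f p.2 with hgdef
  have hg0 : ∀ p, 0 ≤ g p := fun p => mul_nonneg (hf0 _) (hf0 _)
  set E' := E.filter (fun p => p.1 - p.2 ≠ 0 ∧ gcdP (p.1 - p.2) ∣ τ) with hE'
  set d : Pt × Pt → (Pt × ℤ) × (Fin 3 × Fin 3) := fun p =>
    ((p.1 - p.2, dotP p.1 (p.1 - p.2)), (T p.1 (p.1 - p.2), T p.2 (p.1 - p.2))) with hd
  set X : Fin 3 × Fin 3 → Set Quad := fun t =>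
    {Q : Quad | Q ∈ QZeroAB S C m (t.1 + 1) (t.2 + 1) ∧ gcdP (Q 0 - Q 3) ∣ τ} with hX
  set W : Fin 3 × Fin 3 → ℝ := fun t => ∑' Q : Quad, (X t).indicator (fQ f) Q with hW
  have hWsum : ∀ t, W t = ∑ p ∈ E, ∑ q ∈ E,
      if edgesEquivQuad (p, q) ∈ X t then g p * g q else 0 :=
    fun t => tsum_indicator_fQ f A hfA (X t)
  obtain ⟨t₀, -, ht₀⟩ := Finset.exists_max_image Finset.univ W Finset.univ_nonempty
  have hmem : ∀ i : Fin 3, ((i : ℕ) + 1) ∈ ({1, 2, 3} : Set ℕ) := by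
    intro i; fin_cases i <;> simp
  refine ⟨t₀.1 + 1, hmem _, t₀.2 + 1, hmem _, ?_⟩
  change _ ≤ 200 * (W t₀ + N ^ 2)
  have hW0 : ∀ t, 0 ≤ W t := by
    intro t
    rw [hWsum]
    refine Finset.sum_nonneg fun p _ => Finset.sum_nonneg fun q _ => ?_
    split_ifs
    · exact mul_nonneg (hg0 _) (hg0 _)
    · exact le_rfl
  have hgsq : ∑ p ∈ E, g p ^ 2 = N ^ 2 := by
    rw [hNsum, sq (∑ ξ ∈ A, f ξ ^ 2), Finset.sum_mul_sum, hE, Finset.sum_product]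
    refine Finset.sum_congr rfl fun x _ => Finset.sum_congr rfl fun y _ => ?_
    rw [hgdef]
    ring
  have hgdiag : ∑ p ∈ E, (if p.1 = p.2 then g p else 0) = N := by
    rw [hNsum, hE, Finset.sum_product]
    refine Finset.sum_congr rfl fun x hx => ?_
    rw [Finset.sum_ite_eq, if_pos hx, hgdef, sq]
  have hzero : ∑ p ∈ E, ∑ q ∈ E, (if p.1 = p.2 ∧ q.1 = q.2 then g p * g q else 0) = N ^ 2 := by
    rw [sq, ← hgdiag, Finset.sum_mul_sum]
    refine Finset.sum_congr rfl fun p _ => Finset.sum_congr rfl fun q _ => ?_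
    by_cases h1 : p.1 = p.2 <;> by_cases h2 : q.1 = q.2 <;> simp [h1, h2]
  have hmain : ∑' Q : Quad, Set.indicator {Q : Quad | IsPara Q ∧ tauQ Q = (τ : ℤ)} (fQ f) Q ≤
      N ^ 2 + ∑ p ∈ E', ∑ q ∈ E', if LabelRel τ (d p) (d q) then g p * g q else 0 := by
    have hE'sum : ∑ p ∈ E', ∑ q ∈ E', (if LabelRel τ (d p) (d q) then g p * g q else 0) =
        ∑ p ∈ E, ∑ q ∈ E, if p ∈ E' ∧ q ∈ E' ∧ LabelRel τ (d p) (d q) then g p * g q else 0 := by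
      have hinter : E' = E.filter (· ∈ E') := by
        ext p
        simp only [hE', Finset.mem_filter]
        tauto
      conv_lhs => rw [hinter, Finset.sum_filter]
      refine Finset.sum_congr rfl fun p _ => ?_
      rw [Finset.sum_filter]
      by_cases hp : p ∈ E'
      · rw [if_pos hp]
        refine Finset.sum_congr rfl fun q _ => ?_
        by_cases hq : q ∈ E' <;> simp [hp, hq]
      · simp [hp]
    rw [tsum_indicator_fQ f A hfA, ← hzero, hE'sum, ← Finset.sum_add_distrib]
    refine Finset.sum_le_sum fun p hp => ?_
    rw [← Finset.sum_add_distrib]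
    refine Finset.sum_le_sum fun q hq => ?_
    have hgg := mul_nonneg (hg0 p) (hg0 q)
    by_cases hQ : edgesEquivQuad (p, q) ∈ {Q : Quad | IsPara Q ∧ tauQ Q = (τ : ℤ)}
    · rw [if_pos hQ]
      obtain ⟨hpara, htau⟩ := hQ
      have hv := (isPara_edgesEquivQuad p q).1 hpara
      have hgcd := gcdP_dvd_of_tauQ_eq htau
      by_cases h0 : p.1 - p.2 = 0
      · rw [if_pos ⟨sub_eq_zero.1 h0, sub_eq_zero.1 (hv ▸ h0)⟩]
        refine le_add_of_nonneg_right ?_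
        split_ifs
        · exact hgg
        · exact le_rfl
      · rw [tauQ, dotQ_edgesEquivQuad hv] at htau
        have hpE : p ∈ E' := Finset.mem_filter.2 ⟨hp, h0, hgcd⟩
        have hqE : q ∈ E' := Finset.mem_filter.2 ⟨hq, hv ▸ h0, hv ▸ hgcd⟩
        rw [if_pos (c := p ∈ E' ∧ q ∈ E' ∧ LabelRel τ (d p) (d q)) ⟨hpE, hqE, hv, htau⟩]
        refine le_add_of_nonneg_left ?_
        split_ifs
        · exact hgg
        · exact le_rfl
    · rw [if_neg hQ]
      refine add_nonneg ?_ ?_ <;> split_ifs <;> first | exact hgg | exact le_rfl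
  have hschur := sum_rel_le_card_mul_sum_eq E' g d (LabelRel τ) (fun _ _ h => h.symm) 18
    (card_filter_labelRel_le τ)
  have hdiag : ∑ p ∈ E', ∑ q ∈ E', (if d p = d q then g p * g q else 0) ≤
      N ^ 2 + ∑ t, W t := by
    have hstep : ∀ p ∈ E', ∀ q ∈ E', (if d p = d q then g p * g q else 0) ≤
        (if p = q then g p ^ 2 else 0) +
          ∑ t, if edgesEquivQuad (p, q) ∈ X t then g p * g q else 0 := by
      intro p hp q hq
      have hnn : ∀ t, 0 ≤ if edgesEquivQuad (p, q) ∈ X t then g p * g q else 0 := by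
        intro t
        split_ifs
        · exact mul_nonneg (hg0 _) (hg0 _)
        · exact le_rfl
      have hsn := Finset.sum_nonneg fun t (_ : t ∈ Finset.univ) => hnn t
      by_cases hpq : p = q
      · subst hpq
        rw [if_pos rfl, if_pos rfl, sq]
        exact le_add_of_nonneg_right hsn
      rw [if_neg hpq, zero_add]
      split_ifs with hdd
      · simp only [hE', hE, Finset.mem_filter, Finset.mem_product] at hp hq
        simp only [hd, Prod.mk.injEq] at hdd
        obtain ⟨⟨h1, h2⟩, h3, h4⟩ := hdd
        have hmemX : edgesEquivQuad (p, q) ∈ X (T p.1 (p.1 - p.2), T p.2 (p.1 - p.2)) :=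
          ⟨edgesEquivQuad_mem_QZeroAB hpq hp.2.1 h1 h2 (hT _ _ hp.1.1) (hT _ _ hp.1.2)
            (h3 ▸ hT _ _ hq.1.1) (h4 ▸ hT _ _ hq.1.2), hp.2.2⟩
        refine le_trans ?_ (Finset.single_le_sum (fun t _ => hnn t)
          (Finset.mem_univ (T p.1 (p.1 - p.2), T p.2 (p.1 - p.2))))
        rw [if_pos hmemX]
      · exact hsn
    have hsub : E' ⊆ E := Finset.filter_subset _ _
    calc ∑ p ∈ E', ∑ q ∈ E', (if d p = d q then g p * g q else 0)
        ≤ ∑ p ∈ E', ∑ q ∈ E', ((if p = q then g p ^ 2 else 0) +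
          ∑ t, if edgesEquivQuad (p, q) ∈ X t then g p * g q else 0) :=
          Finset.sum_le_sum fun p hp => Finset.sum_le_sum fun q hq => hstep p hp q hq
      _ ≤ ∑ p ∈ E, ∑ q ∈ E, ((if p = q then g p ^ 2 else 0) +
          ∑ t, if edgesEquivQuad (p, q) ∈ X t then g p * g q else 0) := by
          have hnn : ∀ p q, 0 ≤ (if p = q then g p ^ 2 else 0) +
              ∑ t, if edgesEquivQuad (p, q) ∈ X t then g p * g q else 0 := by
            intro p q
            refine add_nonneg ?_ (Finset.sum_nonneg fun t _ => ?_)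
            · split_ifs
              · exact sq_nonneg _
              · exact le_rfl
            · split_ifs
              · exact mul_nonneg (hg0 _) (hg0 _)
              · exact le_rfl
          refine (Finset.sum_le_sum fun p _ =>
            Finset.sum_le_sum_of_subset_of_nonneg hsub fun q _ _ => hnn p q).trans ?_
          exact Finset.sum_le_sum_of_subset_of_nonneg hsub
            fun p _ _ => Finset.sum_nonneg fun q _ => hnn p q
      _ = N ^ 2 + ∑ t, W t := by
          simp only [Finset.sum_add_distrib]
          congr 1
          · rw [← hgsq]
            refine Finset.sum_congr rfl fun p hp => ?_
            rw [Finset.sum_ite_eq, if_pos hp]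
          · simp only [hWsum]
            exact (Finset.sum_congr rfl fun p _ => Finset.sum_comm).trans Finset.sum_comm
  have hWmax : ∑ t, W t ≤ 9 * W t₀ := by
    refine (Finset.sum_le_card_nsmul Finset.univ W (W t₀) ht₀).trans_eq ?_
    simp [Finset.card_univ]
  have := hW0 t₀
  push_cast at hschur
  nlinarith [sq_nonneg N]
end
end

section
/- For every constant C ∈ ℕ there exists c > 0 such that the following holds. Let m ≥ 1, let S₀,…,S_m be disjoint subsets of ℤ² with #S_j ≤ 2^j, let λ₀,…,λ_m ≥ 0, and let f = Σ_{j=0}^m λ_j 2^{−j/2} χ_{S_j}. Assume that for each j and each ξ ∈ S_j there exists at most one line ℓ through ξ with #(ℓ ∩ S_j) ≥ 2^{j/2+C}. Then for every β ∈ {1,2,3}, Σ_{Q ∈ 𝒬⁰_{1,β}} f(Q) ≤ c (Σ_{j=0}^m λ_j²)². -/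
open scoped BigOperators

noncomputable section

/-- Some `S_j` containing `x` has at least `2^{j/2+C}` points on `ℓ`. -/
def IsHeavyAt (S : ℕ → Finset Pt) (C m : ℕ) (x : Pt) (ℓ : Set (ℝ × ℝ)) : Prop :=
  ∃ j ≤ m, x ∈ S j ∧ (2 : ℝ) ^ ((j : ℝ) / 2 + (C : ℝ)) ≤ (lineCount ℓ (S j) : ℝ)

lemma emb_injective : Function.Injective emb := by
  intro x y h
  simpa [emb, Prod.ext_iff] using h

lemma isLine_lineThrough {p q : Pt} (h : p ≠ q) : IsLine (lineThrough p q) :=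
  ⟨emb p, emb q - emb p, sub_ne_zero.mpr fun e => h (emb_injective e).symm, rfl⟩

lemma left_mem_lineThrough (p q : Pt) : emb p ∈ lineThrough p q := ⟨0, by simp⟩

lemma right_mem_lineThrough (p q : Pt) : emb q ∈ lineThrough p q := ⟨1, by simp⟩

lemma VertexType.isHeavyAt {S : ℕ → Finset Pt} {C m : ℕ} {x y z : Pt}
    (h : VertexType S C m 1 x y z) :
    IsHeavyAt S C m x (lineThrough x y) ∨ IsHeavyAt S C m x (lineThrough x z) := by
  obtain ⟨j, hj, hx, ⟨-, h⟩ | ⟨h, -⟩ | ⟨h, -⟩⟩ := h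
  · rw [crossMax, Nat.cast_max, le_max_iff] at h
    exact h.imp (fun h => ⟨j, hj, hx, h⟩) (fun h => ⟨j, hj, hx, h⟩)
  · omega
  · omega

lemma VertexType.exists_mem {S : ℕ → Finset Pt} {C m α : ℕ} {x y z : Pt}
    (h : VertexType S C m α x y z) : ∃ j ≤ m, x ∈ S j := by
  obtain ⟨j, hj, hx, -⟩ := h
  exact ⟨j, hj, hx⟩

/-- The foot of the perpendicular from `c` to a line through `a` is unique. -/
lemma eq_of_lineThrough_eq {a b b' c : Pt} (hb' : a ≠ b')
    (h : (b.1 - a.1) * (c.1 - b.1) + (b.2 - a.2) * (c.2 - b.2) = 0)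
    (h' : (b'.1 - a.1) * (c.1 - b'.1) + (b'.2 - a.2) * (c.2 - b'.2) = 0)
    (hl : lineThrough a b = lineThrough a b') : b = b' := by
  obtain ⟨t, ht⟩ : emb b' ∈ lineThrough a b := hl ▸ right_mem_lineThrough a b'
  obtain ⟨a₁, a₂⟩ := a
  obtain ⟨b₁, b₂⟩ := b
  obtain ⟨d₁, d₂⟩ := b'
  obtain ⟨c₁, c₂⟩ := c
  simp only [emb, Prod.ext_iff, Prod.fst_add, Prod.snd_add, Prod.smul_fst, Prod.smul_snd,
    Prod.fst_sub, Prod.snd_sub, smul_eq_mul] at ht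
  obtain ⟨h1, h2⟩ := ht
  have g : ((b₁ : ℝ) - a₁) * (c₁ - b₁) + (b₂ - a₂) * (c₂ - b₂) = 0 := by exact_mod_cast h
  have g' : ((d₁ : ℝ) - a₁) * (c₁ - d₁) + (d₂ - a₂) * (c₂ - d₂) = 0 := by exact_mod_cast h'
  have key : t * (t - 1) * (((b₁ : ℝ) - a₁) ^ 2 + (b₂ - a₂) ^ 2) = 0 := by
    rw [h1, h2] at g'
    linear_combination t * g - g'
  have ht : t ≠ 0 := by
    rintro rfl
    apply hb'
    simp only [zero_mul, add_zero, Int.cast_inj] at h1 h2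
    rw [h1, h2]
  rcases mul_eq_zero.mp key with hk | hk
  · have ht1 : t = 1 := by
      rcases mul_eq_zero.mp hk with hk | hk
      · exact absurd hk ht
      · linarith
    subst ht1
    have e1 : (b₁ : ℝ) = d₁ := by linarith
    have e2 : (b₂ : ℝ) = d₂ := by linarith
    exact Prod.ext (by exact_mod_cast e1) (by exact_mod_cast e2)
  · have e1 : (b₁ : ℝ) - a₁ = 0 := by
      nlinarith [sq_nonneg ((b₁ : ℝ) - a₁), sq_nonneg ((b₂ : ℝ) - a₂)]
    have e2 : (b₂ : ℝ) - a₂ = 0 := by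
      nlinarith [sq_nonneg ((b₁ : ℝ) - a₁), sq_nonneg ((b₂ : ℝ) - a₂)]
    rw [e1] at h1
    rw [e2] at h2
    simp only [mul_zero, add_zero, Int.cast_inj] at h1 h2
    exact absurd (Prod.ext h1.symm h2.symm) hb'

lemma IsRect.add_opposite {Q : Quad} (h : IsRect Q) (k : Fin 4) :
    Q k + Q (k + 2) = Q (k + 1) + Q (k + 3) := by
  have h1 : Q 0 + Q 2 = Q 1 + Q 3 := h.1
  fin_cases k
  · exact h1
  · exact h1.symm.trans (add_comm _ _)
  · exact ((add_comm _ _).trans h1).trans (add_comm _ _)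
  · exact ((add_comm _ _).trans h1.symm)

lemma IsRect.dot_next {Q : Quad} (h : IsRect Q) (k : Fin 4) :
    ((Q (k + 1)).1 - (Q k).1) * ((Q (k + 2)).1 - (Q (k + 1)).1) +
      ((Q (k + 1)).2 - (Q k).2) * ((Q (k + 2)).2 - (Q (k + 1)).2) = 0 := by
  obtain ⟨h1, h2⟩ := h
  obtain ⟨e1, e2⟩ := Prod.ext_iff.mp h1
  simp only [Prod.fst_add, Prod.snd_add] at e1 e2
  have e1' : (Q 3).1 = (Q 0).1 + (Q 2).1 - (Q 1).1 := by linarith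
  have e2' : (Q 3).2 = (Q 0).2 + (Q 2).2 - (Q 1).2 := by linarith
  rw [dotQ, e1', e2'] at h2
  fin_cases k <;> simp [e1', e2'] <;>
    first | linear_combination h2 | linear_combination -h2

lemma IsRect.dot_prev {Q : Quad} (h : IsRect Q) (k : Fin 4) :
    ((Q (k + 3)).1 - (Q k).1) * ((Q (k + 2)).1 - (Q (k + 3)).1) +
      ((Q (k + 3)).2 - (Q k).2) * ((Q (k + 2)).2 - (Q (k + 3)).2) = 0 := by
  obtain ⟨e1, e2⟩ := Prod.ext_iff.mp (h.add_opposite k)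
  have h2 := h.dot_next k
  simp only [Prod.fst_add, Prod.snd_add] at e1 e2
  have e1' : (Q (k + 3)).1 = (Q k).1 + (Q (k + 2)).1 - (Q (k + 1)).1 := by linarith
  have e2' : (Q (k + 3)).2 = (Q k).2 + (Q (k + 2)).2 - (Q (k + 1)).2 := by linarith
  rw [e1', e2']
  linear_combination h2

lemma quad_ext {Q Q' : Quad} (k : Fin 4) (h0 : Q k = Q' k) (h1 : Q (k + 1) = Q' (k + 1))
    (h2 : Q (k + 2) = Q' (k + 2)) (h3 : Q (k + 3) = Q' (k + 3)) : Q = Q' := by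
  funext i
  fin_cases k <;> fin_cases i <;> assumption

/-- If `p` maps `T` to `V` and is injective on each of two pieces covering `T`, then
`∑_T g ∘ p ≤ 2 ∑_V g`. -/
lemma sum_comp_le_two_mul_sum {ι κ : Type*} {T : Finset ι} {V : Finset κ} {p : ι → κ}
    {g : κ → ℝ} {A B : ι → Prop} (hp : ∀ Q ∈ T, p Q ∈ V) (hg : ∀ v, 0 ≤ g v)
    (hAB : ∀ Q ∈ T, A Q ∨ B Q)
    (hA : ∀ Q ∈ T, ∀ Q' ∈ T, A Q → A Q' → p Q = p Q' → Q = Q')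
    (hB : ∀ Q ∈ T, ∀ Q' ∈ T, B Q → B Q' → p Q = p Q' → Q = Q') :
    ∑ Q ∈ T, g (p Q) ≤ 2 * ∑ v ∈ V, g v := by
  classical
  have piece : ∀ P : ι → Prop,
      (∀ Q ∈ T, ∀ Q' ∈ T, P Q → P Q' → p Q = p Q' → Q = Q') →
      ∑ Q ∈ T with P Q, g (p Q) ≤ ∑ v ∈ V, g v := by
    intro P hP
    rw [← Finset.sum_image (f := g) (g := p)]
    · refine Finset.sum_le_sum_of_subset_of_nonneg ?_ fun v _ _ => hg v
      intro v hv
      obtain ⟨Q, hQ, rfl⟩ := Finset.mem_image.mp hv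
      exact hp Q (Finset.mem_filter.mp hQ).1
    · intro Q hQ Q' hQ' h
      have hQ := Finset.mem_filter.mp hQ
      have hQ' := Finset.mem_filter.mp hQ'
      exact hP Q hQ.1 Q' hQ'.1 hQ.2 hQ'.2 h
  have hT : ∑ Q ∈ T, g (p Q) ≤ ∑ Q ∈ T with A Q, g (p Q) + ∑ Q ∈ T with B Q, g (p Q) := by
    rw [Finset.sum_filter, Finset.sum_filter, ← Finset.sum_add_distrib]
    refine Finset.sum_le_sum fun Q hQ => ?_
    have := hg (p Q)
    rcases hAB Q hQ with h | h
    · rw [if_pos h]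
      split_ifs <;> linarith
    · rw [if_pos h]
      split_ifs <;> linarith
  linarith [piece A hA, piece B hB]

/-- If at most one line through each point satisfies `H`, and one of the two sides at the `k`-th
vertex lies on such a line, then the sum of `f² f²` over the
diagonals through that vertex is at most twice the sum over all pairs. -/
lemma sum_diagonal_le {H : Pt → Set (ℝ × ℝ) → Prop}
    (hH : ∀ x ℓ₁ ℓ₂, IsLine ℓ₁ → IsLine ℓ₂ → emb x ∈ ℓ₁ → emb x ∈ ℓ₂ →
      H x ℓ₁ → H x ℓ₂ → ℓ₁ = ℓ₂)
    (f : Pt → ℝ) {U : Finset Pt} {T : Finset Quad} (k : Fin 4)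
    (hU : ∀ Q ∈ T, ∀ i, Q i ∈ U) (hR : ∀ Q ∈ T, IsRect Q)
    (hI : ∀ Q ∈ T, Function.Injective Q)
    (hT : ∀ Q ∈ T, H (Q k) (lineThrough (Q k) (Q (k + 1))) ∨
      H (Q k) (lineThrough (Q k) (Q (k + 3)))) :
    ∑ Q ∈ T, f (Q k) ^ 2 * f (Q (k + 2)) ^ 2 ≤ 2 * (∑ x ∈ U, f x ^ 2) ^ 2 := by
  have hk1 : k ≠ k + 1 := by fin_cases k <;> decide
  have hk3 : k ≠ k + 3 := by fin_cases k <;> decide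
  have key := sum_comp_le_two_mul_sum (T := T) (V := U ×ˢ U)
    (p := fun Q => (Q k, Q (k + 2))) (g := fun v => f v.1 ^ 2 * f v.2 ^ 2)
    (fun Q hQ => Finset.mem_product.mpr ⟨hU Q hQ _, hU Q hQ _⟩) (fun v => by positivity) hT
    ?_ ?_
  · rwa [sq (∑ x ∈ U, f x ^ 2), Finset.sum_mul_sum, ← Finset.sum_product']
  · intro Q hQ Q' hQ' h h' hp
    obtain ⟨e0, e2⟩ := Prod.ext_iff.mp hp
    simp only at e0 e2
    have n := (hI Q hQ).ne hk1
    have n' := (hI Q' hQ').ne hk1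
    have d := (hR Q hQ).dot_next k
    have d' := (hR Q' hQ').dot_next k
    have s := (hR Q hQ).add_opposite k
    rw [← e0] at h' n' d'
    rw [← e2] at d'
    have e1 := eq_of_lineThrough_eq n' d d' <|
      hH _ _ _ (isLine_lineThrough n) (isLine_lineThrough n') (left_mem_lineThrough _ _)
        (left_mem_lineThrough _ _) h h'
    rw [e0, e2, (hR Q' hQ').add_opposite k, e1] at s
    exact quad_ext k e0 e1 e2 (add_left_cancel s).symm
  · intro Q hQ Q' hQ' h h' hp
    obtain ⟨e0, e2⟩ := Prod.ext_iff.mp hp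
    simp only at e0 e2
    have n := (hI Q hQ).ne hk3
    have n' := (hI Q' hQ').ne hk3
    have d := (hR Q hQ).dot_prev k
    have d' := (hR Q' hQ').dot_prev k
    have s := (hR Q hQ).add_opposite k
    rw [← e0] at h' n' d'
    rw [← e2] at d'
    have e3 := eq_of_lineThrough_eq n' d d' <|
      hH _ _ _ (isLine_lineThrough n) (isLine_lineThrough n') (left_mem_lineThrough _ _)
        (left_mem_lineThrough _ _) h h'
    rw [e0, e2, (hR Q' hQ').add_opposite k, e3] at s
    exact quad_ext k e0 (add_right_cancel s).symm e2 e3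

lemma fWt_eq_of_mem {S : ℕ → Finset Pt} {lam : ℕ → ℝ} {m j : ℕ} {x : Pt}
    (hS : ∀ i ≤ m, ∀ j ≤ m, i ≠ j → Disjoint (S i) (S j)) (hj : j ≤ m) (hx : x ∈ S j) :
    fWt S lam m x = lam j * (2 : ℝ) ^ (-(j : ℝ) / 2) := by
  rw [fWt, Finset.sum_eq_single j, if_pos hx]
  · intro i hi hij
    have hi : i ≤ m := by simpa [Nat.lt_succ_iff] using hi
    exact if_neg fun hxi => Finset.disjoint_left.mp (hS i hi j hj hij) hxi hx
  · intro h
    exact absurd (Finset.mem_range.mpr (by omega)) h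

lemma sum_fWt_sq_le {S : ℕ → Finset Pt} {lam : ℕ → ℝ} {m : ℕ}
    (hS : ∀ i ≤ m, ∀ j ≤ m, i ≠ j → Disjoint (S i) (S j))
    (hc : ∀ j ≤ m, (S j).card ≤ 2 ^ j) :
    ∑ x ∈ (Finset.range (m + 1)).biUnion S, fWt S lam m x ^ 2 ≤
      ∑ j ∈ Finset.range (m + 1), lam j ^ 2 := by
  rw [Finset.sum_biUnion]
  · refine Finset.sum_le_sum fun j hj => ?_
    have hj : j ≤ m := by simpa [Nat.lt_succ_iff] using hj
    rw [Finset.sum_congr rfl fun x hx => by rw [fWt_eq_of_mem hS hj hx], Finset.sum_const,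
      nsmul_eq_mul, mul_pow, ← Real.rpow_natCast (2 ^ _), ← Real.rpow_mul zero_le_two]
    have e : -(j : ℝ) / 2 * ((2 : ℕ) : ℝ) = -(j : ℝ) := by push_cast; ring
    rw [e, Real.rpow_neg zero_le_two, Real.rpow_natCast]
    have hcard : ((S j).card : ℝ) ≤ 2 ^ j := by exact_mod_cast hc j hj
    calc ((S j).card : ℝ) * (lam j ^ 2 * (2 ^ j)⁻¹)
        ≤ 2 ^ j * (lam j ^ 2 * (2 ^ j)⁻¹) := by gcongr
      _ = lam j ^ 2 := by field_simp
  · intro i hi j hj hij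
    have hi : i ≤ m := by simpa [Nat.lt_succ_iff] using hi
    have hj : j ≤ m := by simpa [Nat.lt_succ_iff] using hj
    exact hS i hi j hj hij

/-- **Case I (3.5) of Lemma 3.3.** For `α = 1` (and by symmetry any case with a
type-1 pair), `Σ_{Q ∈ 𝒬⁰_{1,β}} f(Q) ≲ ‖λ‖_{ℓ²}⁴`. -/
theorem sum_QZeroAB_type1_bound (C : ℕ) :
    ∃ c : ℝ, 0 < c ∧
      ∀ (m : ℕ) (S : ℕ → Finset Pt) (lam : ℕ → ℝ),
        1 ≤ m →
        (∀ i ≤ m, ∀ j ≤ m, i ≠ j → Disjoint (S i) (S j)) →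
        (∀ j ≤ m, (S j).card ≤ 2 ^ j) →
        (∀ j ≤ m, 0 ≤ lam j) →
        (∀ j ≤ m, ∀ ξ ∈ S j, ∀ ℓ₁ ℓ₂ : Set (ℝ × ℝ), IsLine ℓ₁ → IsLine ℓ₂ →
          emb ξ ∈ ℓ₁ → emb ξ ∈ ℓ₂ →
          (2 : ℝ) ^ ((j : ℝ) / 2 + (C : ℝ)) ≤ (lineCount ℓ₁ (S j) : ℝ) →
          (2 : ℝ) ^ ((j : ℝ) / 2 + (C : ℝ)) ≤ (lineCount ℓ₂ (S j) : ℝ) → ℓ₁ = ℓ₂) →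
        ∀ β ∈ ({1, 2, 3} : Set ℕ),
          ∑' Q : Quad, Set.indicator (QZeroAB S C m 1 β) (fQ (fWt S lam m)) Q ≤
            c * (∑ j ∈ Finset.range (m + 1), lam j ^ 2) ^ 2 := by
  classical
  refine ⟨2, two_pos, ?_⟩
  intro m S lam _ hS hc _ hline β _
  have hH : ∀ x ℓ₁ ℓ₂, IsLine ℓ₁ → IsLine ℓ₂ → emb x ∈ ℓ₁ → emb x ∈ ℓ₂ →
      IsHeavyAt S C m x ℓ₁ → IsHeavyAt S C m x ℓ₂ → ℓ₁ = ℓ₂ := by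
    rintro x ℓ₁ ℓ₂ h₁ h₂ hx₁ hx₂ ⟨j, hj, hxj, c₁⟩ ⟨i, hi, hxi, c₂⟩
    obtain rfl : i = j := by
      by_contra hij
      exact Finset.disjoint_left.mp (hS i hi j hj hij) hxi hxj
    exact hline i hi x hxi ℓ₁ ℓ₂ h₁ h₂ hx₁ hx₂ c₁ c₂
  set U := (Finset.range (m + 1)).biUnion S
  set f := fWt S lam m
  set T := {Q ∈ Fintype.piFinset fun _ : Fin 4 => U | Q ∈ QZeroAB S C m 1 β}
  have hmem : ∀ {x}, (∃ j ≤ m, x ∈ S j) → x ∈ U := by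
    rintro x ⟨j, hj, hx⟩
    exact Finset.mem_biUnion.mpr ⟨j, Finset.mem_range.mpr (by omega), hx⟩
  have hTQ : ∀ Q ∈ T, Q ∈ QZeroAB S C m 1 β := fun Q hQ => (Finset.mem_filter.mp hQ).2
  have hTU : ∀ Q ∈ T, ∀ i, Q i ∈ U := fun Q hQ =>
    Fintype.mem_piFinset.mp (Finset.mem_filter.mp hQ).1
  have hQT : ∀ Q ∈ QZeroAB S C m 1 β, Q ∈ T := by
    intro Q hQ
    refine Finset.mem_filter.mpr ⟨Fintype.mem_piFinset.mpr fun i => ?_, hQ⟩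
    obtain ⟨-, -, h0, h1, h2, h3⟩ := hQ
    fin_cases i
    exacts [hmem h0.exists_mem, hmem h1.exists_mem, hmem h2.exists_mem, hmem h3.exists_mem]
  rw [tsum_eq_sum (s := T) fun Q hQ => Set.indicator_of_notMem (fun h => hQ (hQT Q h)) _,
    Finset.sum_congr rfl fun Q hQ => Set.indicator_of_mem (hTQ Q hQ) _]
  have d0 := sum_diagonal_le hH f 0 hTU (fun Q hQ => (hTQ Q hQ).1) (fun Q hQ => (hTQ Q hQ).2.1)
    (fun Q hQ => (hTQ Q hQ).2.2.1.isHeavyAt)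
  have d1 := sum_diagonal_le hH f 1 hTU (fun Q hQ => (hTQ Q hQ).1) (fun Q hQ => (hTQ Q hQ).2.1)
    (fun Q hQ => (hTQ Q hQ).2.2.2.1.isHeavyAt)
  have amgm : ∑ Q ∈ T, fQ f Q ≤
      (∑ Q ∈ T, f (Q 0) ^ 2 * f (Q 2) ^ 2 + ∑ Q ∈ T, f (Q 1) ^ 2 * f (Q 3) ^ 2) / 2 := by
    rw [← Finset.sum_add_distrib, Finset.sum_div]
    refine Finset.sum_le_sum fun Q _ => ?_
    rw [fQ, Fin.prod_univ_four]
    nlinarith [sq_nonneg (f (Q 0) * f (Q 2) - f (Q 1) * f (Q 3))]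
  have hsq : (∑ x ∈ U, f x ^ 2) ^ 2 ≤ (∑ j ∈ Finset.range (m + 1), lam j ^ 2) ^ 2 :=
    pow_le_pow_left₀ (Finset.sum_nonneg fun x _ => sq_nonneg _) (sum_fWt_sq_le hS hc) 2
  have d0' : ∑ Q ∈ T, f (Q 0) ^ 2 * f (Q 2) ^ 2 ≤ 2 * (∑ x ∈ U, f x ^ 2) ^ 2 := d0
  have d1' : ∑ Q ∈ T, f (Q 1) ^ 2 * f (Q 3) ^ 2 ≤ 2 * (∑ x ∈ U, f x ^ 2) ^ 2 := d1
  linarith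
end
end

section
/- For every constant C ∈ ℕ there exists c > 0 such that the following holds. Let m ≥ 1, let S₀,…,S_m be disjoint subsets of ℤ² with #S_j ≤ 2^j, let λ₀,…,λ_m ≥ 0, and let f = Σ_{j=0}^m λ_j 2^{−j/2} χ_{S_j}. Assume that for each j and each ξ ∈ S_j there exists at most one line ℓ through ξ with #(ℓ ∩ S_j) ≥ 2^{j/2+C}. Then Σ_{Q ∈ 𝒬⁰_{2,2}} f(Q) ≤ c · m · (Σ_{j=0}^m λ_j²)². -/
open scoped BigOperators

noncomputable section

/-- An affine function without zeros in `(a, b)` which is positive somewhere in `(a, b]` is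
nonnegative at `a`. -/
lemma affine_nonneg_left {s t a b x₀ : ℝ} (hne : ∀ x, a < x → x < b → s * x + t ≠ 0)
    (hax : a < x₀) (hxb : x₀ ≤ b) (hpos : 0 < s * x₀ + t) : 0 ≤ s * a + t := by
  by_contra! hneg
  have hs : 0 < s := by
    by_contra! hs
    nlinarith
  have hz : s * (-t / s) + t = 0 := by field_simp; ring
  refine hne (-t / s) ?_ ?_ hz
  · by_contra! h
    nlinarith
  · by_contra! h
    nlinarith

/-- A family of segments, given by their lines `y = σ x + β` and their left and right endpoints,
whose endpoints lie in `V`, and which do not meet each other or `V` in their relative interiors,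
has at most `3 * #V` members. -/
lemma card_le_of_noncrossing {ι : Type*} (V : Finset (ℝ × ℝ))
    (hV : Set.InjOn Prod.fst (V : Set (ℝ × ℝ))) (E : Finset ι) (σ β : ι → ℝ) (l r : ι → ℝ × ℝ)
    (hl : ∀ i ∈ E, l i ∈ V) (hr : ∀ i ∈ E, r i ∈ V) (hlr : ∀ i ∈ E, (l i).1 < (r i).1)
    (hly : ∀ i ∈ E, (l i).2 = σ i * (l i).1 + β i)
    (hry : ∀ i ∈ E, (r i).2 = σ i * (r i).1 + β i)
    (hfree : ∀ i ∈ E, ∀ v ∈ V, (l i).1 < v.1 → v.1 < (r i).1 → v.2 ≠ σ i * v.1 + β i)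
    (hcross : ∀ i ∈ E, ∀ j ∈ E, i ≠ j → ∀ x, (l i).1 < x → x < (r i).1 → (l j).1 < x →
      x < (r j).1 → σ i * x + β i ≠ σ j * x + β j) :
    E.card ≤ 3 * V.card := by
  classical
  set Tl := E.filter fun i => ∀ j ∈ E, l j = l i → σ j ≤ σ i with hTl
  set Tr := E.filter fun i => ∀ j ∈ E, r j = r i → σ i ≤ σ j with hTr
  set Ts := E.filter fun i => ∃ v ∈ V, (l i).1 < v.1 ∧ v.1 < (r i).1 ∧ σ i * v.1 + β i < v.2 ∧
    ∀ j ∈ E, (l j).1 < v.1 → v.1 < (r j).1 → σ j * v.1 + β j < v.2 →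
      σ j * v.1 + β j ≤ σ i * v.1 + β i with hTs
  have cl : Tl.card ≤ V.card := by
    refine Finset.card_le_card_of_injOn l (fun i hi => hl i (Finset.mem_filter.1 hi).1) ?_
    intro i hi j hj hij
    obtain ⟨hi, hi'⟩ := Finset.mem_filter.1 hi
    obtain ⟨hj, hj'⟩ := Finset.mem_filter.1 hj
    by_contra hne
    have hs : σ i = σ j := le_antisymm (hj' i hi hij) (hi' j hj hij.symm)
    have h1 := hly i hi
    have h2 := hly j hj
    obtain ⟨x, hx, hx'⟩ := exists_between (lt_min (hlr i hi) (hij ▸ hlr j hj))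
    have := lt_min_iff.1 hx'
    refine hcross i hi j hj hne x hx this.1 (hij ▸ hx) this.2 ?_
    rw [← hij, ← hs] at h2
    rw [← hs]; linarith
  have cr : Tr.card ≤ V.card := by
    refine Finset.card_le_card_of_injOn r (fun i hi => hr i (Finset.mem_filter.1 hi).1) ?_
    intro i hi j hj hij
    obtain ⟨hi, hi'⟩ := Finset.mem_filter.1 hi
    obtain ⟨hj, hj'⟩ := Finset.mem_filter.1 hj
    by_contra hne
    have hs : σ i = σ j := le_antisymm (hi' j hj hij.symm) (hj' i hi hij)
    have h1 := hry i hi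
    have h2 := hry j hj
    obtain ⟨x, hx, hx'⟩ := exists_between (max_lt (hlr i hi) (hij ▸ hlr j hj))
    have := max_lt_iff.1 hx
    refine hcross i hi j hj hne x this.1 hx' this.2 (hij ▸ hx') ?_
    rw [← hij, ← hs] at h2
    rw [← hs]; linarith
  have cs : Ts.card ≤ V.card := by
    have hv : ∀ i ∈ Ts, ∃ v ∈ V, (l i).1 < v.1 ∧ v.1 < (r i).1 ∧ σ i * v.1 + β i < v.2 ∧
      ∀ j ∈ E, (l j).1 < v.1 → v.1 < (r j).1 → σ j * v.1 + β j < v.2 →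
        σ j * v.1 + β j ≤ σ i * v.1 + β i := fun i hi => (Finset.mem_filter.1 hi).2
    choose! v hvV h1 h2 h3 h4 using hv
    refine Finset.card_le_card_of_injOn v (fun i hi => hvV i hi) ?_
    intro i hi j hj hij
    have hi' := (Finset.mem_filter.1 hi).1
    have hj' := (Finset.mem_filter.1 hj).1
    by_contra hne
    refine hcross i hi' j hj' hne (v i).1 (h1 i hi) (h2 i hi) (hij ▸ h1 j hj) (hij ▸ h2 j hj) ?_
    refine le_antisymm ?_ (h4 i hi j hj' (hij ▸ h1 j hj) (hij ▸ h2 j hj) (hij ▸ h3 j hj))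
    rw [hij]
    exact h4 j hj i hi' (hij ▸ h1 i hi) (hij ▸ h2 i hi) (hij ▸ h3 i hi)
  have hcover : E ⊆ Tl ∪ Tr ∪ Ts := by
    intro i hi
    by_cases hiT : i ∈ Tl
    · simp [hiT]
    obtain ⟨j₀, hj₀, hlj₀, hσj₀⟩ : ∃ j ∈ E, l j = l i ∧ σ i < σ j := by
      by_contra! h
      exact hiT (Finset.mem_filter.2 ⟨hi, h⟩)
    obtain ⟨j, hj, hjmin⟩ := Finset.exists_min_image (E.filter fun j => l j = l i ∧ σ i < σ j) σ
      ⟨j₀, Finset.mem_filter.2 ⟨hj₀, hlj₀, hσj₀⟩⟩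
    obtain ⟨hj, hlj, hσj⟩ := Finset.mem_filter.1 hj
    have hyi := hly i hi
    have hyj := hly j hj
    rw [hlj] at hyj
    have hlt : ∀ x, (l i).1 < x → σ i * x + β i < σ j * x + β j := fun x hx => by nlinarith
    have hri := hry i hi
    have hrj := hry j hj
    obtain ⟨w, hw, hwmin⟩ := Finset.exists_min_image (V.filter fun v => (l i).1 < v.1 ∧
      v.1 ≤ (r i).1 ∧ v.1 ≤ (r j).1 ∧ σ i * v.1 + β i ≤ v.2 ∧ v.2 ≤ σ j * v.1 + β j) Prod.fst (by
        rcases le_total (r i).1 (r j).1 with h | h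
        · exact ⟨r i, Finset.mem_filter.2 ⟨hr i hi, hlr i hi, le_rfl, h, hri.ge,
            hri ▸ (hlt _ (hlr i hi)).le⟩⟩
        · have := hlr j hj
          rw [hlj] at this
          exact ⟨r j, Finset.mem_filter.2 ⟨hr j hj, this, h, le_rfl, hrj ▸ (hlt _ this).le,
            hrj.le⟩⟩)
    obtain ⟨hwV, hlw, hwi, hwj, hiw, hjw⟩ := Finset.mem_filter.1 hw
    have key : ∀ g ∈ E, ∀ x₀ x₁, (l g).1 < x₀ → x₀ ≤ (r g).1 → (l i).1 < x₀ → x₀ ≤ w.1 →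
        (l g).1 < x₁ → x₁ ≤ (r g).1 → (l i).1 < x₁ → x₁ ≤ w.1 →
        σ i * x₀ + β i < σ g * x₀ + β g → σ g * x₁ + β g < σ j * x₁ + β j → False := by
      intro g hg x₀ x₁ g0 g0' l0 w0 g1 g1' l1 w1 h0 h1
      have hgi : i ≠ g := by rintro rfl; exact lt_irrefl _ h0
      have hgj : g ≠ j := by rintro rfl; exact lt_irrefl _ h1
      have n0 : 0 ≤ (σ g - σ i) * max (l g).1 (l i).1 + (β g - β i) := by
        refine affine_nonneg_left (b := min (r g).1 (r i).1) ?_ (max_lt g0 l0)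
          (le_min g0' (w0.trans hwi)) (by linarith)
        intro x hx hx' h
        have := max_lt_iff.1 hx
        have := lt_min_iff.1 hx'
        refine hcross i hi g hg hgi x ?_ ?_ ?_ ?_ ?_ <;> first | tauto | linarith
      have n1 : 0 ≤ (σ j - σ g) * max (l g).1 (l i).1 + (β j - β g) := by
        refine affine_nonneg_left (b := min (r g).1 (r j).1) ?_ (max_lt g1 l1)
          (le_min g1' (w1.trans hwj)) (by linarith)
        intro x hx hx' h
        have := max_lt_iff.1 hx
        have := lt_min_iff.1 hx'
        refine hcross g hg j hj hgj x ?_ ?_ ?_ ?_ ?_ <;>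
          first | (rw [hlj]; tauto) | tauto | linarith
      have hyg := hly g hg
      rcases lt_or_ge (l i).1 (l g).1 with h | h
      · rw [max_eq_left h.le] at n0 n1
        have := hwmin (l g) (Finset.mem_filter.2 ⟨hl g hg, h, by linarith, by linarith,
          by linarith, by linarith⟩)
        linarith
      · rw [max_eq_right h] at n0 n1
        have hpg : (l i).2 = σ g * (l i).1 + β g := by linarith
        rcases h.lt_or_eq with h | h
        · exact hfree g hg (l i) (hl i hi) h (l0.trans_le g0') hpg
        · have hlg : l g = l i := hV (hl g hg) (hl i hi) h
          have s0 : σ i < σ g := by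
            by_contra! hs
            nlinarith
          have s1 : σ g < σ j := by
            by_contra! hs
            nlinarith
          exact absurd (hjmin g (Finset.mem_filter.2 ⟨hg, hlg, s0⟩)) (not_le.2 s1)
    rcases hwi.lt_or_eq with hwi' | hwi'
    · refine Finset.mem_union_right _ (Finset.mem_filter.2 ⟨hi, w, hwV, hlw, hwi',
        hiw.lt_of_ne fun h => hfree i hi w hwV hlw hwi' h.symm, ?_⟩)
      intro g hg h1 h2 h3
      by_contra! h4
      exact key g hg w.1 w.1 h1 h2.le hlw le_rfl h1 h2.le hlw le_rfl h4 (by linarith)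
    · have hwr : w = r i := hV hwV (hr i hi) hwi'
      subst hwr
      refine Finset.mem_union_left _ (Finset.mem_union_right _ (Finset.mem_filter.2 ⟨hi, ?_⟩))
      intro g hg hrg
      by_contra! hσ
      have hyg := hry g hg
      have hlg := hlr g hg
      rw [hrg] at hyg hlg
      obtain ⟨x, hx, hx'⟩ := exists_between (max_lt hlg (hlr i hi))
      have hm := max_lt_iff.1 hx
      refine key g hg x (r i).1 hm.1 (by rw [hrg]; exact hx'.le) hm.2 hx'.le hlg (by rw [hrg])
        hlw le_rfl ?_ ?_
      · nlinarith
      · have := hlt _ hlw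
        linarith
  calc E.card ≤ (Tl ∪ Tr ∪ Ts).card := Finset.card_le_card hcover
    _ ≤ Tl.card + Tr.card + Ts.card :=
      (Finset.card_union_le _ _).trans (Nat.add_le_add_right (Finset.card_union_le _ _) _)
    _ ≤ 3 * V.card := by omega

/-- The same bound as in `card_le_of_noncrossing`, with the crossing pairs listed in `X` allowed. -/
lemma card_le_add_crossing {ι : Type*} (V : Finset (ℝ × ℝ))
    (hV : Set.InjOn Prod.fst (V : Set (ℝ × ℝ))) (E : Finset ι) (σ β : ι → ℝ) (l r : ι → ℝ × ℝ)
    (X : Finset (ι × ι))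
    (hl : ∀ i ∈ E, l i ∈ V) (hr : ∀ i ∈ E, r i ∈ V) (hlr : ∀ i ∈ E, (l i).1 < (r i).1)
    (hly : ∀ i ∈ E, (l i).2 = σ i * (l i).1 + β i)
    (hry : ∀ i ∈ E, (r i).2 = σ i * (r i).1 + β i)
    (hfree : ∀ i ∈ E, ∀ v ∈ V, (l i).1 < v.1 → v.1 < (r i).1 → v.2 ≠ σ i * v.1 + β i)
    (hcross : ∀ i ∈ E, ∀ j ∈ E, i ≠ j → ∀ x, (l i).1 < x → x < (r i).1 → (l j).1 < x →
      x < (r j).1 → σ i * x + β i = σ j * x + β j → (i, j) ∈ X) :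
    E.card ≤ 3 * V.card + X.card := by
  classical
  have h1 : (E \ X.image Prod.fst).card ≤ 3 * V.card := by
    refine card_le_of_noncrossing V hV _ σ β l r ?_ ?_ ?_ ?_ ?_ ?_ ?_
    · exact fun i hi => hl i (Finset.mem_sdiff.1 hi).1
    · exact fun i hi => hr i (Finset.mem_sdiff.1 hi).1
    · exact fun i hi => hlr i (Finset.mem_sdiff.1 hi).1
    · exact fun i hi => hly i (Finset.mem_sdiff.1 hi).1
    · exact fun i hi => hry i (Finset.mem_sdiff.1 hi).1
    · exact fun i hi => hfree i (Finset.mem_sdiff.1 hi).1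
    · intro i hi j hj hne x h1 h2 h3 h4 h
      obtain ⟨hi, hi'⟩ := Finset.mem_sdiff.1 hi
      exact hi' (Finset.mem_image_of_mem Prod.fst
        (hcross i hi j (Finset.mem_sdiff.1 hj).1 hne x h1 h2 h3 h4 h))
  have h2 := Finset.card_le_card_sdiff_add_card (t := X.image Prod.fst) (s := E)
  have h3 := Finset.card_image_le (s := X) (f := Prod.fst)
  omega

/-- A random subset of `V`, each point being chosen independently with probability `p`, contains
`T` with probability `p ^ #T`. -/
lemma sum_powerset_weight {α : Type*} [DecidableEq α] (V T : Finset α) (hT : T ⊆ V) (p : ℝ) :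
    ∑ A ∈ V.powerset, p ^ A.card * (1 - p) ^ (V \ A).card * (if T ⊆ A then 1 else 0)
      = p ^ T.card := by
  have h := Finset.prod_add (fun _ : α => p) (fun i => if i ∈ T then 0 else 1 - p) V
  have h1 : ∏ i ∈ V, (p + if i ∈ T then 0 else 1 - p) = p ^ T.card := by
    rw [← Finset.prod_const, ← Finset.prod_subset hT]
    · exact Finset.prod_congr rfl fun i hi => by simp [hi]
    · intro i _ hi
      simp [hi]
  rw [← h1, h]
  refine Finset.sum_congr rfl fun A hA => ?_
  rw [Finset.prod_const, mul_assoc]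
  congr 1
  split_ifs with hTA
  · rw [mul_one, ← Finset.prod_const]
    refine Finset.prod_congr rfl fun i hi => ?_
    rw [if_neg fun h => (Finset.mem_sdiff.1 hi).2 (hTA h)]
  · obtain ⟨i, hi, hiA⟩ := Finset.not_subset.1 hTA
    rw [mul_zero]
    symm
    exact Finset.prod_eq_zero (i := i) (Finset.mem_sdiff.2 ⟨hT hi, hiA⟩) (if_pos hi)

/-- The expected number of sets `T i`, all of size `n`, that lie in a random subset of `V`. -/
lemma sum_powerset_weight_card {α κ : Type*} [DecidableEq α] (V : Finset α) (p : ℝ)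
    (F : Finset κ) (T : κ → Finset α) (n : ℕ) (hT : ∀ i ∈ F, T i ⊆ V ∧ (T i).card = n) :
    ∑ A ∈ V.powerset, p ^ A.card * (1 - p) ^ (V \ A).card *
      ((F.filter fun i => T i ⊆ A).card : ℝ) = p ^ n * F.card := by
  simp_rw [Finset.card_filter, Nat.cast_sum, Finset.mul_sum]
  rw [Finset.sum_comm]
  rw [Finset.sum_congr rfl fun i hi => ?_, Finset.sum_const, nsmul_eq_mul, mul_comm]
  rw [← (hT i hi).2, ← sum_powerset_weight V (T i) (hT i hi).1 p]
  push_cast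
  rfl

/-- Averaging `card_le_add_crossing` over random subsets of the vertices. -/
lemma sampled_crossing {ι : Type*} (V : Finset (ℝ × ℝ))
    (hV : Set.InjOn Prod.fst (V : Set (ℝ × ℝ))) (E : Finset ι) (σ β : ι → ℝ) (l r : ι → ℝ × ℝ)
    (X : Finset (ι × ι))
    (hl : ∀ i ∈ E, l i ∈ V) (hr : ∀ i ∈ E, r i ∈ V) (hlr : ∀ i ∈ E, (l i).1 < (r i).1)
    (hly : ∀ i ∈ E, (l i).2 = σ i * (l i).1 + β i)
    (hry : ∀ i ∈ E, (r i).2 = σ i * (r i).1 + β i)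
    (hfree : ∀ i ∈ E, ∀ v ∈ V, (l i).1 < v.1 → v.1 < (r i).1 → v.2 ≠ σ i * v.1 + β i)
    (hcross : ∀ i ∈ E, ∀ j ∈ E, i ≠ j → ∀ x, (l i).1 < x → x < (r i).1 → (l j).1 < x →
      x < (r j).1 → σ i * x + β i = σ j * x + β j → (i, j) ∈ X)
    (hXE : ∀ c ∈ X, c.1 ∈ E ∧ c.2 ∈ E)
    (hX : ∀ c ∈ X, l c.1 ≠ l c.2 ∧ l c.1 ≠ r c.2 ∧ r c.1 ≠ l c.2 ∧ r c.1 ≠ r c.2)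
    {p : ℝ} (hp : 0 ≤ p) (hp' : p ≤ 1) :
    p ^ 2 * E.card ≤ 3 * (p * V.card) + p ^ 4 * X.card := by
  classical
  have hE := sum_powerset_weight_card V p E (fun i => {l i, r i}) 2 fun i hi => by
    refine ⟨by simp [Finset.insert_subset_iff, hl i hi, hr i hi], Finset.card_pair fun h => ?_⟩
    exact (hlr i hi).ne (congrArg Prod.fst h)
  have hXs := sum_powerset_weight_card V p X (fun c => {l c.1, r c.1, l c.2, r c.2}) 4 fun c hc => by
    obtain ⟨h1, h2⟩ := hXE c hc
    obtain ⟨h3, h4, h5, h6⟩ := hX c hc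
    have h7 : l c.1 ≠ r c.1 := fun h => (hlr _ h1).ne (congrArg Prod.fst h)
    have h8 : l c.2 ≠ r c.2 := fun h => (hlr _ h2).ne (congrArg Prod.fst h)
    refine ⟨by simp [Finset.insert_subset_iff, hl _ h1, hr _ h1, hl _ h2, hr _ h2], ?_⟩
    rw [Finset.card_insert_of_notMem (by simp [*]), Finset.card_insert_of_notMem (by simp [*]),
      Finset.card_pair h8]
  have hVs := sum_powerset_weight_card V p V (fun v => {v}) 1 fun v hv => by simp [hv]
  rw [pow_one] at hVs
  rw [← hE, ← hXs, ← hVs, Finset.mul_sum, ← Finset.sum_add_distrib]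
  refine Finset.sum_le_sum fun A hA => ?_
  have hA := Finset.mem_powerset.1 hA
  have hle : (E.filter fun i => ({l i, r i} : Finset (ℝ × ℝ)) ⊆ A).card ≤
      3 * A.card + (X.filter fun c => ({l c.1, r c.1, l c.2, r c.2} : Finset (ℝ × ℝ)) ⊆ A).card := by
    simp only [Finset.insert_subset_iff, Finset.singleton_subset_iff]
    refine card_le_add_crossing A (hV.mono (by exact_mod_cast hA)) _ σ β l r _ ?_ ?_ ?_ ?_ ?_ ?_ ?_
    · exact fun i hi => (Finset.mem_filter.1 hi).2.1
    · exact fun i hi => (Finset.mem_filter.1 hi).2.2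
    · exact fun i hi => hlr i (Finset.mem_filter.1 hi).1
    · exact fun i hi => hly i (Finset.mem_filter.1 hi).1
    · exact fun i hi => hry i (Finset.mem_filter.1 hi).1
    · exact fun i hi v hv => hfree i (Finset.mem_filter.1 hi).1 v (hA hv)
    · intro i hi j hj hne x h1 h2 h3 h4 h
      obtain ⟨hi, hi'⟩ := Finset.mem_filter.1 hi
      obtain ⟨hj, hj'⟩ := Finset.mem_filter.1 hj
      exact Finset.mem_filter.2 ⟨hcross i hi j hj hne x h1 h2 h3 h4 h, hi'.1, hi'.2, hj'.1, hj'.2⟩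
  have hAV : (V.filter fun v => ({v} : Finset (ℝ × ℝ)) ⊆ A) = A := by
    ext v
    simp only [Finset.mem_filter, Finset.singleton_subset_iff]
    exact ⟨And.right, fun h => ⟨hA h, h⟩⟩
  rw [hAV]
  have hle' : ((E.filter fun i => ({l i, r i} : Finset (ℝ × ℝ)) ⊆ A).card : ℝ) ≤
      3 * A.card + (X.filter fun c => ({l c.1, r c.1, l c.2, r c.2} : Finset (ℝ × ℝ)) ⊆ A).card := by
    exact_mod_cast hle
  have hw : 0 ≤ p ^ A.card * (1 - p) ^ (V \ A).card :=
    mul_nonneg (pow_nonneg hp _) (pow_nonneg (by linarith) _)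
  calc _ ≤ _ := mul_le_mul_of_nonneg_left hle' hw
    _ = _ := by ring

/-- Optimisation of the sampling probability in the proof of the Szemerédi–Trotter theorem, for
`v` points, `n` lines with at least `κ` points each, `e` edges and `X` crossings. -/
lemma rich_lines_arith {v n κ e X : ℝ} (hv0 : 0 ≤ v) (hn0 : 0 ≤ n) (hκ2 : 2 ≤ κ)
    (hE : n * κ ≤ 2 * e) (hve : v = 0 → e = 0) (hX : X ≤ n ^ 2)
    (hsamp : ∀ p : ℝ, 0 ≤ p → p ≤ 1 → p ^ 2 * e ≤ 3 * (p * v) + p ^ 4 * X) :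
    n * κ ^ 3 ≤ 576 * v ^ 2 + 12 * v * κ ^ 2 := by
  have hκ : 0 < κ := by linarith
  have hvκ : 0 ≤ 12 * v * κ ^ 2 := by positivity
  rcases le_or_gt e (6 * v) with h | h
  · have h1 : n * κ * κ ^ 2 ≤ 12 * v * κ ^ 2 :=
      mul_le_mul_of_nonneg_right (by linarith) (sq_nonneg κ)
    have h2 : n * κ ^ 3 = n * κ * κ ^ 2 := by ring
    have h3 := sq_nonneg v
    linarith
  have he : 0 < e := by linarith
  have hv : 0 < v := hv0.lt_of_ne fun h => he.ne' (hve h.symm)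
  have h1 := hsamp (6 * v / e) (by positivity) (by rw [div_le_one he]; exact h.le)
  have h3 : (6 * v / e) ^ 2 * e = 18 * v ^ 2 / e + 18 * v ^ 2 / e := by field_simp; ring
  have h4 : 3 * (6 * v / e * v) = 18 * v ^ 2 / e := by ring
  have h5 : (6 * v / e) ^ 4 * X ≤ (6 * v / e) ^ 4 * n ^ 2 :=
    mul_le_mul_of_nonneg_left hX (by positivity)
  have h6 : 18 * v ^ 2 / e ≤ (6 * v / e) ^ 4 * n ^ 2 := by linarith
  have h7 : 18 * v ^ 2 * e ^ 3 ≤ 18 * v ^ 2 * (72 * v ^ 2 * n ^ 2) := by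
    calc 18 * v ^ 2 * e ^ 3 = 18 * v ^ 2 / e * e ^ 4 := by field_simp
      _ ≤ (6 * v / e) ^ 4 * n ^ 2 * e ^ 4 := by gcongr
      _ = _ := by field_simp; ring
  have h8 : e ^ 3 ≤ 72 * v ^ 2 * n ^ 2 := le_of_mul_le_mul_left h7 (by positivity)
  have h9 : (n * κ) ^ 3 ≤ (2 * e) ^ 3 := by gcongr
  have h10 : n ^ 2 * (n * κ ^ 3) ≤ n ^ 2 * (576 * v ^ 2) := by
    calc n ^ 2 * (n * κ ^ 3) = (n * κ) ^ 3 := by ring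
      _ ≤ 8 * e ^ 3 := by linarith
      _ ≤ 8 * (72 * v ^ 2 * n ^ 2) := by gcongr
      _ = _ := by ring
  rcases hn0.eq_or_lt with hn | hn
  · rw [← hn, zero_mul]
    positivity
  · have := le_of_mul_le_mul_left h10 (by positivity)
    linarith

/-- **Szemerédi–Trotter theorem**, rich lines version: the number of lines `y = σ x + β` that
contain at least `k ≥ 2` points of a finite set with distinct abscissae. -/
lemma card_rich_lines_graph (V : Finset (ℝ × ℝ)) (hV : Set.InjOn Prod.fst (V : Set (ℝ × ℝ)))
    (L : Finset (ℝ × ℝ)) (k : ℕ) (hk : 2 ≤ k)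
    (hL : ∀ ℓ ∈ L, k ≤ (V.filter fun v => v.2 = ℓ.1 * v.1 + ℓ.2).card) :
    (L.card : ℝ) * k ^ 3 ≤ 576 * (V.card : ℝ) ^ 2 + 12 * V.card * k ^ 2 := by
  classical
  set E := (L ×ˢ V).filter fun i => i.2.2 = i.1.1 * i.2.1 + i.1.2 ∧
    ∃ q ∈ V, q.2 = i.1.1 * q.1 + i.1.2 ∧ i.2.1 < q.1 with hE
  have hr : ∀ i ∈ E, ∃ q ∈ V, q.2 = i.1.1 * q.1 + i.1.2 ∧ i.2.1 < q.1 ∧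
      ∀ v ∈ V, v.2 = i.1.1 * v.1 + i.1.2 → i.2.1 < v.1 → q.1 ≤ v.1 := by
    intro i hi
    obtain ⟨q, hqV, hq, hq'⟩ := (Finset.mem_filter.1 hi).2.2
    obtain ⟨r, hr, hr'⟩ := Finset.exists_min_image
      (V.filter fun q => q.2 = i.1.1 * q.1 + i.1.2 ∧ i.2.1 < q.1) Prod.fst
      ⟨q, Finset.mem_filter.2 ⟨hqV, hq, hq'⟩⟩
    obtain ⟨h1, h2, h3⟩ := Finset.mem_filter.1 hr
    exact ⟨r, h1, h2, h3, fun v hv h4 h5 => hr' v (Finset.mem_filter.2 ⟨hv, h4, h5⟩)⟩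
  choose! r hrV hry hlr hrmin using hr
  have hEL : ∀ i ∈ E, i.1 ∈ L := fun i hi => (Finset.mem_product.1 (Finset.mem_filter.1 hi).1).1
  have hlV : ∀ i ∈ E, i.2 ∈ V := fun i hi => (Finset.mem_product.1 (Finset.mem_filter.1 hi).1).2
  have hly : ∀ i ∈ E, i.2.2 = i.1.1 * i.2.1 + i.1.2 := fun i hi => (Finset.mem_filter.1 hi).2.1
  have hsame : ∀ i ∈ E, ∀ j ∈ E, i.1 = j.1 → ∀ x, i.2.1 < x → x < (r i).1 → j.2.1 < x →
      x < (r j).1 → i = j := by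
    intro i hi j hj hij x h1 h2 h3 h4
    have e1 : i.2.1 = j.2.1 := by
      rcases lt_trichotomy i.2.1 j.2.1 with h | h | h
      · have := hrmin i hi j.2 (hlV j hj) (by rw [hij]; exact hly j hj) h
        linarith
      · exact h
      · have := hrmin j hj i.2 (hlV i hi) (by rw [← hij]; exact hly i hi) h
        linarith
    exact Prod.ext hij (hV (hlV i hi) (hlV j hj) e1)
  set X := (E ×ˢ E).filter fun c => c.1 ≠ c.2 ∧ ∃ x, c.1.2.1 < x ∧ x < (r c.1).1 ∧ c.2.2.1 < x ∧
    x < (r c.2).1 ∧ c.1.1.1 * x + c.1.1.2 = c.2.1.1 * x + c.2.1.2 with hXdef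
  have hmeet : ∀ a b : ℝ × ℝ, a ≠ b → ∀ x y : ℝ, a.1 * x + a.2 = b.1 * x + b.2 →
      a.1 * y + a.2 = b.1 * y + b.2 → x = y := by
    intro a b hab x y hx hy
    by_contra hxy
    have h1 : (a.1 - b.1) * (x - y) = 0 := by linarith
    rcases mul_eq_zero.1 h1 with h | h
    · have h2 : a.1 = b.1 := by linarith
      exact hab (Prod.ext h2 (by rw [h2] at hx; linarith))
    · exact hxy (by linarith)
  have hX4 : ∀ c ∈ X, c.1.2 ≠ c.2.2 ∧ c.1.2 ≠ r c.2 ∧ r c.1 ≠ c.2.2 ∧ r c.1 ≠ r c.2 := by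
    intro c hc
    obtain ⟨hc, hne, x, h1, h2, h3, h4, h5⟩ := Finset.mem_filter.1 hc
    obtain ⟨hi, hj⟩ := Finset.mem_product.1 hc
    have hne' : c.1.1 ≠ c.2.1 := fun h => hne (hsame _ hi _ hj h x h1 h2 h3 h4)
    have a1 := hly _ hi
    have a2 := hly _ hj
    have a3 := hry _ hi
    have a4 := hry _ hj
    have hm := fun y => hmeet _ _ hne' x y h5
    refine ⟨fun h => ?_, fun h => ?_, fun h => ?_, fun h => ?_⟩
    · exact h1.ne' (hm _ (by rw [← a1, h, ← a2]))
    · exact h1.ne' (hm _ (by rw [← a1, h, ← a4]))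
    · exact h2.ne (hm _ (by rw [← a3, h, ← a2]))
    · exact h2.ne (hm _ (by rw [← a3, h, ← a4]))
  have hXcard : X.card ≤ L.card ^ 2 := by
    rw [sq, ← Finset.card_product]
    refine Finset.card_le_card_of_injOn (fun c => (c.1.1, c.2.1)) ?_ ?_
    · intro c hc
      obtain ⟨hi, hj⟩ := Finset.mem_product.1 (Finset.mem_filter.1 hc).1
      exact Finset.mem_coe.2 (Finset.mem_product.2 ⟨hEL c.1 hi, hEL c.2 hj⟩)
    · intro c hc d hd hcd
      obtain ⟨hc, hne, x, h1, h2, h3, h4, h5⟩ := Finset.mem_filter.1 hc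
      obtain ⟨hd, _, y, g1, g2, g3, g4, g5⟩ := Finset.mem_filter.1 hd
      obtain ⟨hi, hj⟩ := Finset.mem_product.1 hc
      obtain ⟨hi', hj'⟩ := Finset.mem_product.1 hd
      have e1 : c.1.1 = d.1.1 := (Prod.ext_iff.1 hcd).1
      have e2 : c.2.1 = d.2.1 := (Prod.ext_iff.1 hcd).2
      have hne' : c.1.1 ≠ c.2.1 := fun h => hne (hsame _ hi _ hj h x h1 h2 h3 h4)
      rw [← e1, ← e2] at g5
      obtain rfl := hmeet _ _ hne' x y h5 g5
      exact Prod.ext (hsame _ hi _ hi' e1 x h1 h2 g1 g2) (hsame _ hj _ hj' e2 x h3 h4 g3 g4)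
  have hEcard : L.card * (k - 1) ≤ E.card := by
    have hmaps : Set.MapsTo Prod.fst (E : Set ((ℝ × ℝ) × ℝ × ℝ)) (L : Set (ℝ × ℝ)) :=
      fun i hi => hEL i hi
    rw [Finset.card_eq_sum_card_fiberwise hmaps, ← smul_eq_mul]
    refine Finset.card_nsmul_le_sum _ _ _ fun ℓ hℓ => ?_
    set F := V.filter fun v => v.2 = ℓ.1 * v.1 + ℓ.2 with hF
    have hFk := hL ℓ hℓ
    obtain ⟨q, hq, hqmax⟩ := Finset.exists_max_image F Prod.fst
      (Finset.card_pos.1 (by rw [hF]; omega))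
    refine (Nat.sub_le_sub_right hFk 1).trans ?_
    rw [← Finset.card_erase_of_mem hq]
    refine Finset.card_le_card_of_injOn (fun v => (ℓ, v)) ?_ fun v _ w _ h => congrArg Prod.snd h
    intro v hv
    obtain ⟨hvq, hvF⟩ := Finset.mem_erase.1 hv
    obtain ⟨hvV, hv⟩ := Finset.mem_filter.1 hvF
    obtain ⟨hqV, hq⟩ := Finset.mem_filter.1 hq
    exact Finset.mem_filter.2 ⟨Finset.mem_filter.2 ⟨Finset.mem_product.2 ⟨hℓ, hvV⟩, hv, q, hqV, hq,
      (hqmax v hvF).lt_of_ne fun h => hvq (hV hvV hqV h)⟩, rfl⟩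
  have hsamp := fun p hp hp' => sampled_crossing V hV E (fun i => i.1.1) (fun i => i.1.2)
    (fun i => i.2) r X hlV hrV hlr hly hry
    (fun i hi v hv h1 h2 h3 => not_lt.2 (hrmin i hi v hv h3 h1) h2)
    (fun i hi j hj hne x h1 h2 h3 h4 h5 => Finset.mem_filter.2
      ⟨Finset.mem_product.2 ⟨hi, hj⟩, hne, x, h1, h2, h3, h4, h5⟩)
    (fun c hc => Finset.mem_product.1 (Finset.mem_filter.1 hc).1) hX4 (p := p) hp hp'
  have hk2 : (2 : ℝ) ≤ k := by exact_mod_cast hk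
  have hEr : (L.card : ℝ) * k ≤ 2 * E.card := by
    have h1 : ((L.card * (k - 1) : ℕ) : ℝ) ≤ E.card := by exact_mod_cast hEcard
    rw [Nat.cast_mul, Nat.cast_sub (by omega), Nat.cast_one] at h1
    have h2 : (0 : ℝ) ≤ L.card := by positivity
    nlinarith
  have hXr : (X.card : ℝ) ≤ (L.card : ℝ) ^ 2 := by exact_mod_cast hXcard
  have hVE : (V.card : ℝ) = 0 → (E.card : ℝ) = 0 := by
    intro h
    have hV0 : V = ∅ := Finset.card_eq_zero.1 (by exact_mod_cast h)
    have hE0 : E = ∅ := Finset.eq_empty_of_forall_notMem fun i hi => by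
      have := hlV i hi
      rw [hV0] at this
      exact Finset.notMem_empty _ this
    rw [hE0, Finset.card_empty, Nat.cast_zero]
  exact rich_lines_arith (Nat.cast_nonneg _) (Nat.cast_nonneg _) hk2 hEr hVE
    hXr hsamp

open Classical in
lemma lineCount_eq_card (ℓ : Set (ℝ × ℝ)) (T : Finset Pt) :
    lineCount ℓ T = (T.filter fun ξ => emb ξ ∈ ℓ).card := by
  rw [lineCount, ← Set.ncard_coe_finset, ← Set.ncard_image_of_injective _ emb_injective]
  congr 1
  ext z
  simp only [Set.mem_inter_iff, Set.mem_image, Finset.mem_coe, Finset.mem_filter]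
  constructor
  · rintro ⟨hz, ξ, hξ, rfl⟩
    exact ⟨ξ, ⟨hξ, hz⟩, rfl⟩
  · rintro ⟨ξ, ⟨hξ, hz⟩, rfl⟩
    exact ⟨hz, ξ, hξ, rfl⟩

/-- Some shear makes the abscissae of a finite set of lattice points distinct. -/
lemma exists_shear (S : Finset Pt) :
    ∃ N : ℤ, Set.InjOn (fun ξ : Pt => N * ξ.1 + ξ.2) (S : Set Pt) := by
  refine ⟨2 * (∑ ξ ∈ S, |ξ.2|) + 1, fun ξ hξ η hη h => ?_⟩
  have h1 := Finset.single_le_sum (f := fun ξ : Pt => |ξ.2|) (fun i _ => abs_nonneg i.2) hξ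
  have h2 := Finset.single_le_sum (f := fun ξ : Pt => |ξ.2|) (fun i _ => abs_nonneg i.2) hη
  simp only at h h1 h2
  generalize (∑ ξ ∈ S, |ξ.2|) = M at *
  have h3 := abs_le.1 h1
  have h4 := abs_le.1 h2
  have h5 : ξ.1 = η.1 := by
    rcases lt_trichotomy ξ.1 η.1 with hlt | heq | hlt
    · nlinarith
    · exact heq
    · nlinarith
  rw [h5] at h
  exact Prod.ext h5 (by linarith)

/-- A line meeting the plane in two points with different values of `N x + y` is a graph over this
coordinate. -/
lemma IsLine.exists_graph {ℓ : Set (ℝ × ℝ)} (hℓ : IsLine ℓ) (N : ℝ) {z w : ℝ × ℝ} (hz : z ∈ ℓ)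
    (hw : w ∈ ℓ) (hzw : N * z.1 + z.2 ≠ N * w.1 + w.2) :
    ∃ c : ℝ × ℝ, ∀ x : ℝ × ℝ, x ∈ ℓ ↔ x.1 = c.1 * (N * x.1 + x.2) + c.2 := by
  obtain ⟨p, v, -, rfl⟩ := hℓ
  obtain ⟨t, rfl⟩ := hz
  obtain ⟨t', rfl⟩ := hw
  have hu : N * v.1 + v.2 ≠ 0 := by
    intro h
    apply hzw
    simp only [Prod.fst_add, Prod.smul_fst, Prod.snd_add, Prod.smul_snd, smul_eq_mul]
    linear_combination (t - t') * h
  refine ⟨(v.1 / (N * v.1 + v.2), p.1 - v.1 / (N * v.1 + v.2) * (N * p.1 + p.2)), fun x => ?_⟩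
  constructor
  · rintro ⟨t, rfl⟩
    simp only [Prod.fst_add, Prod.smul_fst, Prod.snd_add, Prod.smul_snd, smul_eq_mul]
    linear_combination -t * div_mul_cancel₀ v.1 hu
  · intro h
    simp only at h
    have h1 : x.1 = p.1 + (N * x.1 + x.2 - (N * p.1 + p.2)) / (N * v.1 + v.2) * v.1 := by
      linear_combination h
    have h2 : (N * x.1 + x.2 - (N * p.1 + p.2)) / (N * v.1 + v.2) * (N * v.1 + v.2) =
        N * x.1 + x.2 - (N * p.1 + p.2) := div_mul_cancel₀ _ hu
    refine ⟨(N * x.1 + x.2 - (N * p.1 + p.2)) / (N * v.1 + v.2), Prod.ext h1 ?_⟩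
    simp only [Prod.snd_add, Prod.smul_snd, smul_eq_mul]
    linear_combination -h2 - N * h1

/-- **Szemerédi–Trotter theorem** for lattice points: the number of lines containing at least
`k ≥ 2` points of `S`. -/
lemma card_rich_lines (S : Finset Pt) (L : Finset (Set (ℝ × ℝ))) (k : ℕ) (hk : 2 ≤ k)
    (hL : ∀ ℓ ∈ L, IsLine ℓ ∧ k ≤ lineCount ℓ S) :
    (L.card : ℝ) * k ^ 3 ≤ 576 * (S.card : ℝ) ^ 2 + 12 * S.card * k ^ 2 := by
  classical
  obtain ⟨N, hN⟩ := exists_shear S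
  have hc : ∀ ℓ ∈ L, ∃ c : ℝ × ℝ, ∀ x : ℝ × ℝ, x ∈ ℓ ↔ x.1 = c.1 * (N * x.1 + x.2) + c.2 := by
    intro ℓ hℓ
    obtain ⟨hline, hcount⟩ := hL ℓ hℓ
    rw [lineCount_eq_card] at hcount
    obtain ⟨ξ, hξ, η, hη, hne⟩ := Finset.one_lt_card.1 (hk.trans hcount)
    obtain ⟨hξS, hξ⟩ := Finset.mem_filter.1 hξ
    obtain ⟨hηS, hη⟩ := Finset.mem_filter.1 hη
    refine hline.exists_graph N hξ hη fun h => hne (hN hξS hηS ?_)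
    have h' : (N : ℝ) * ξ.1 + ξ.2 = N * η.1 + η.2 := h
    exact_mod_cast h'
  choose! c hc using hc
  set T : Pt → ℝ × ℝ := fun ξ => (N * ξ.1 + ξ.2, ξ.1) with hT
  have hTinj : Set.InjOn T (S : Set Pt) := by
    intro ξ hξ η hη h
    refine hN hξ hη ?_
    have h' : (N : ℝ) * ξ.1 + ξ.2 = N * η.1 + η.2 := congrArg Prod.fst h
    exact_mod_cast h'
  have hVinj : Set.InjOn Prod.fst ((S.image T : Finset (ℝ × ℝ)) : Set (ℝ × ℝ)) := by
    intro z hz w hw h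
    obtain ⟨ξ, hξ, rfl⟩ := Finset.mem_image.1 hz
    obtain ⟨η, hη, rfl⟩ := Finset.mem_image.1 hw
    have h' : (N : ℝ) * ξ.1 + ξ.2 = N * η.1 + η.2 := h
    rw [hN hξ hη (by exact_mod_cast h')]
  have hcinj : Set.InjOn c (L : Set (Set (ℝ × ℝ))) := fun ℓ hℓ ℓ' hℓ' h =>
    Set.ext fun x => by rw [hc ℓ hℓ, hc ℓ' hℓ', h]
  have h := card_rich_lines_graph (S.image T) hVinj (L.image c) k hk ?_
  · rwa [Finset.card_image_of_injOn hcinj, Finset.card_image_of_injOn hTinj] at h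
  · intro d hd
    obtain ⟨ℓ, hℓ, rfl⟩ := Finset.mem_image.1 hd
    refine (hL ℓ hℓ).2.trans ?_
    rw [lineCount_eq_card, ← Finset.card_image_of_injOn
      (hTinj.mono (Finset.coe_subset.2 (Finset.filter_subset _ _)))]
    refine Finset.card_le_card fun z hz => ?_
    obtain ⟨ξ, hξ, rfl⟩ := Finset.mem_image.1 hz
    obtain ⟨hξS, hξ⟩ := Finset.mem_filter.1 hξ
    exact Finset.mem_filter.2 ⟨Finset.mem_image_of_mem T hξS, (hc ℓ hℓ _).1 hξ⟩

/-- The number of incidences of points of `S` with lines containing between `k` and `2 k` points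
of `S`. -/
lemma card_rich_incidences (S : Finset Pt) (I : Finset (Pt × Set (ℝ × ℝ))) (k : ℕ) (hk : 2 ≤ k)
    (hI : ∀ i ∈ I, i.1 ∈ S ∧ IsLine i.2 ∧ emb i.1 ∈ i.2 ∧ k ≤ lineCount i.2 S ∧
      lineCount i.2 S < 2 * k) :
    (I.card : ℝ) * k ^ 2 ≤ 2 * (576 * (S.card : ℝ) ^ 2 + 12 * S.card * k ^ 2) := by
  classical
  have h1 : I.card ≤ 2 * k * (I.image Prod.snd).card := by
    refine Finset.card_le_mul_card_image I _ fun ℓ hℓ => ?_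
    obtain ⟨i, hi, rfl⟩ := Finset.mem_image.1 hℓ
    refine le_trans ?_ (hI i hi).2.2.2.2.le
    rw [lineCount_eq_card]
    refine Finset.card_le_card_of_injOn Prod.fst ?_ ?_
    · intro i' hi'
      obtain ⟨hi', h⟩ := Finset.mem_filter.1 hi'
      exact Finset.mem_filter.2 ⟨(hI i' hi').1, h ▸ (hI i' hi').2.2.1⟩
    · intro a ha b hb hab
      exact Prod.ext hab ((Finset.mem_filter.1 ha).2.trans (Finset.mem_filter.1 hb).2.symm)
  have h2 := card_rich_lines S (I.image Prod.snd) k hk fun ℓ hℓ => by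
    obtain ⟨i, hi, rfl⟩ := Finset.mem_image.1 hℓ
    exact ⟨(hI i hi).2.1, (hI i hi).2.2.2.1⟩
  have h3 : (I.card : ℝ) ≤ 2 * k * (I.image Prod.snd).card := by exact_mod_cast h1
  calc (I.card : ℝ) * k ^ 2 ≤ 2 * k * (I.image Prod.snd).card * k ^ 2 := by gcongr
    _ = 2 * (((I.image Prod.snd).card : ℝ) * k ^ 3) := by ring
    _ ≤ _ := by gcongr

lemma mem_lineThrough_iff {p q : Pt} (h : p ≠ q) (x : Pt) :
    emb x ∈ lineThrough p q ↔ (q.1 - p.1) * (x.2 - p.2) = (q.2 - p.2) * (x.1 - p.1) := by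
  constructor
  · rintro ⟨t, ht⟩
    have h1 : (x.1 : ℝ) = p.1 + t * (q.1 - p.1) := congrArg Prod.fst ht
    have h2 : (x.2 : ℝ) = p.2 + t * (q.2 - p.2) := congrArg Prod.snd ht
    have : ((q.1 : ℝ) - p.1) * (x.2 - p.2) = (q.2 - p.2) * (x.1 - p.1) := by
      rw [h1, h2]; ring
    exact_mod_cast this
  · intro hx
    have hx' : ((q.1 : ℝ) - p.1) * (x.2 - p.2) = (q.2 - p.2) * (x.1 - p.1) := by exact_mod_cast hx
    by_cases h1 : q.1 = p.1
    · have h2 : (q.2 : ℝ) - p.2 ≠ 0 := by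
        intro h2
        exact h (Prod.ext h1.symm (by exact_mod_cast (sub_eq_zero.1 h2).symm))
      have h3 : (x.1 : ℝ) - p.1 = 0 := by
        have h1' : (q.1 : ℝ) = p.1 := by exact_mod_cast h1
        rw [h1', sub_self, zero_mul] at hx'
        exact (mul_eq_zero.1 hx'.symm).resolve_left h2
      refine ⟨(x.2 - p.2) / (q.2 - p.2), Prod.ext ?_ ?_⟩
      · change (x.1 : ℝ) = p.1 + (x.2 - p.2) / (q.2 - p.2) * (q.1 - p.1)
        rw [h1]; linarith
      · change (x.2 : ℝ) = p.2 + (x.2 - p.2) / (q.2 - p.2) * (q.2 - p.2)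
        field_simp; ring
    · have h2 : (q.1 : ℝ) - p.1 ≠ 0 := sub_ne_zero.2 (by exact_mod_cast h1)
      refine ⟨(x.1 - p.1) / (q.1 - p.1), Prod.ext ?_ ?_⟩
      · change (x.1 : ℝ) = p.1 + (x.1 - p.1) / (q.1 - p.1) * (q.1 - p.1)
        field_simp; ring
      · change (x.2 : ℝ) = p.2 + (x.1 - p.1) / (q.1 - p.1) * (q.2 - p.2)
        field_simp; linarith

/-- Counting objects with two marked points `y`, `z` which are confined successively to the lines
through `y, y'` and `z, z'`. -/
lemma card_le_two_step {κ ρ : Type*} [DecidableEq ρ] (P : Finset κ) (F : κ → ρ)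
    (y y' z z' : κ → Pt) (T U : Finset Pt) (b c : ℕ) (hyT : ∀ i ∈ P, y i ∈ T)
    (hyb : ∀ i ∈ P, lineCount (lineThrough (y i) (y' i)) T ≤ b)
    (hy : ∀ i ∈ P, ∀ i' ∈ P, F i = F i' → emb (y i) ∈ lineThrough (y i') (y' i'))
    (hzU : ∀ i ∈ P, z i ∈ U)
    (hzc : ∀ i ∈ P, lineCount (lineThrough (z i) (z' i)) U ≤ c)
    (hz : ∀ i ∈ P, ∀ i' ∈ P, F i = F i' → y i = y i' → emb (z i) ∈ lineThrough (z i') (z' i'))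
    (hinj : ∀ i ∈ P, ∀ i' ∈ P, F i = F i' → y i = y i' → z i = z i' → i = i') :
    P.card ≤ c * (b * (P.image F).card) := by
  classical
  refine (Finset.card_le_mul_card_image (f := fun i => (F i, y i)) P c fun w hw => ?_).trans
    (Nat.mul_le_mul_left c ?_)
  · obtain ⟨i', hi', rfl⟩ := Finset.mem_image.1 hw
    refine le_trans ?_ (hzc i' hi')
    rw [lineCount_eq_card]
    refine Finset.card_le_card_of_injOn z ?_ ?_
    · intro i hi
      obtain ⟨hi, h⟩ := Finset.mem_filter.1 hi
      obtain ⟨h1, h2⟩ := Prod.ext_iff.1 h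
      exact Finset.mem_filter.2 ⟨hzU i hi, hz i hi i' hi' h1 h2⟩
    · intro i hi k hk hik
      obtain ⟨hi, h⟩ := Finset.mem_filter.1 hi
      obtain ⟨hk, h'⟩ := Finset.mem_filter.1 hk
      obtain ⟨h1, h2⟩ := Prod.ext_iff.1 (h.trans h'.symm)
      exact hinj i hi k hk h1 h2 hik
  · have himg : (P.image fun i => (F i, y i)).image Prod.fst = P.image F := by
      rw [Finset.image_image]; rfl
    rw [← himg]
    refine Finset.card_le_mul_card_image _ b fun w hw => ?_
    rw [himg] at hw
    obtain ⟨i', hi', rfl⟩ := Finset.mem_image.1 hw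
    refine le_trans ?_ (hyb i' hi')
    rw [lineCount_eq_card]
    refine Finset.card_le_card_of_injOn Prod.snd ?_ ?_
    · intro w hw
      obtain ⟨hw, h⟩ := Finset.mem_filter.1 hw
      obtain ⟨i, hi, rfl⟩ := Finset.mem_image.1 hw
      exact Finset.mem_filter.2 ⟨hyT i hi, hy i hi i' hi' h⟩
    · intro w hw x hx hwx
      exact Prod.ext ((Finset.mem_filter.1 hw).2.trans (Finset.mem_filter.1 hx).2.symm) hwx

/-- If `u, u'` are parallel, `u ⟂ w` and `u' ⟂ w'`, then `w, w'` are parallel. -/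
lemma parallel_of_orthogonal {u u' w w' : Pt} (hu : u ≠ 0) (hu' : u' ≠ 0)
    (h : u.1 * u'.2 = u.2 * u'.1) (hw : u.1 * w.1 + u.2 * w.2 = 0)
    (hw' : u'.1 * w'.1 + u'.2 * w'.2 = 0) : w.1 * w'.2 = w.2 * w'.1 := by
  have h1 : u.1 * w'.1 + u.2 * w'.2 = 0 := by
    by_contra hne
    apply hu'
    refine Prod.ext ?_ ?_
    · refine (mul_eq_zero.1 (?_ : u'.1 * (u.1 * w'.1 + u.2 * w'.2) = 0)).resolve_right hne
      linear_combination u.1 * hw' - w'.2 * h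
    · refine (mul_eq_zero.1 (?_ : u'.2 * (u.1 * w'.1 + u.2 * w'.2) = 0)).resolve_right hne
      linear_combination u.2 * hw' + w'.1 * h
  by_contra hne
  have hne' : w.1 * w'.2 - w.2 * w'.1 ≠ 0 := sub_ne_zero.2 hne
  apply hu
  refine Prod.ext ?_ ?_
  · refine (mul_eq_zero.1 (?_ : u.1 * (w.1 * w'.2 - w.2 * w'.1) = 0)).resolve_right hne'
    linear_combination w'.2 * hw - w.2 * h1
  · refine (mul_eq_zero.1 (?_ : u.2 * (w.1 * w'.2 - w.2 * w'.1) = 0)).resolve_right hne'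
    linear_combination w.1 * h1 - w'.1 * hw

/-- `Q` is a nondegenerate rectangle with cyclically ordered vertices `Q k, Q l, Q o, Q n`. -/
structure IsRectAt (Q : Quad) (k l o n : Fin 4) : Prop where
  para : Q k + Q o = Q l + Q n
  orth : (Q l - Q k).1 * (Q n - Q k).1 + (Q l - Q k).2 * (Q n - Q k).2 = 0
  ne_left : Q k ≠ Q l
  ne_right : Q k ≠ Q n

/-- Two rectangles with a common vertex and a common side line there have the same two side lines
at this vertex. -/
lemma IsRectAt.mem_lineThrough {Q Q' : Quad} {k l o n x : Fin 4} (hQ : IsRectAt Q k l o n)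
    (hQ' : IsRectAt Q' k l o n) (hx : x = l ∨ x = n) (hk : Q k = Q' k)
    (h : lineThrough (Q k) (Q x) = lineThrough (Q' k) (Q' x)) :
    emb (Q l) ∈ lineThrough (Q' l) (Q' k) ∧ emb (Q n) ∈ lineThrough (Q' n) (Q' k) := by
  have hpar : ∀ u v w : Pt, u ≠ v → (w - v).1 * (u - v).2 = (w - v).2 * (u - v).1 →
      emb w ∈ lineThrough u v := by
    intro u v w huv h
    rw [mem_lineThrough_iff huv]
    simp only [Prod.fst_sub, Prod.snd_sub] at h
    linear_combination h
  have hxk : ∀ y, Q' k ≠ Q' y → emb (Q y) ∈ lineThrough (Q' k) (Q' y) →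
      (Q y - Q k).1 * (Q' y - Q' k).2 = (Q y - Q k).2 * (Q' y - Q' k).1 := by
    intro y hne hy
    rw [mem_lineThrough_iff hne] at hy
    rw [hk]
    simp only [Prod.fst_sub, Prod.snd_sub]
    linear_combination -hy
  have hmem := right_mem_lineThrough (Q k) (Q x)
  rw [h] at hmem
  have e1 := sub_ne_zero.2 hQ.ne_left.symm
  have e2 := sub_ne_zero.2 hQ.ne_right.symm
  have e3 := sub_ne_zero.2 hQ'.ne_left.symm
  have e4 := sub_ne_zero.2 hQ'.ne_right.symm
  rcases hx with rfl | rfl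
  · have h1 := hxk x hQ'.ne_left hmem
    have h2 := parallel_of_orthogonal e1 e3 h1 hQ.orth hQ'.orth
    rw [hk] at h1 h2
    exact ⟨hpar _ _ _ hQ'.ne_left.symm h1, hpar _ _ _ hQ'.ne_right.symm h2⟩
  · have h1 := hxk x hQ'.ne_right hmem
    have h2 := parallel_of_orthogonal (w := Q l - Q k) (w' := Q' l - Q' k) e2 e4 h1
      (by linear_combination hQ.orth) (by linear_combination hQ'.orth)
    rw [hk] at h1 h2
    exact ⟨hpar _ _ _ hQ'.ne_left.symm h2, hpar _ _ _ hQ'.ne_right.symm h1⟩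

lemma IsRectAt.opposite_mem {Q Q' : Quad} {k l o n : Fin 4} (hQ : IsRectAt Q k l o n)
    (hQ' : IsRectAt Q' k l o n) (hk : Q k = Q' k) (hl : Q l = Q' l)
    (hn : emb (Q n) ∈ lineThrough (Q' n) (Q' k)) : emb (Q o) ∈ lineThrough (Q' o) (Q' l) := by
  have ho : Q o = Q l + Q n - Q k := by rw [← hQ.para]; abel
  have ho' : Q' o = Q' l + Q' n - Q' k := by rw [← hQ'.para]; abel
  rw [mem_lineThrough_iff hQ'.ne_right.symm] at hn
  rw [mem_lineThrough_iff, ho, ho', hl, hk]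
  · simp only [Prod.fst_sub, Prod.snd_sub, Prod.fst_add, Prod.snd_add]
    linear_combination hn
  · rw [ho']
    intro h
    apply hQ'.ne_right
    have h' : Q' l + Q' n - Q' k - (Q' l - Q' k + Q' k) = 0 := by rw [h]; abel
    have : Q' n - Q' k = 0 := by rw [← h']; abel
    exact (sub_eq_zero.1 this).symm

/-- Counting rectangles by their rich side at the vertex `k`. -/
lemma card_rect_le_of_rich_side {P : Finset Quad} {k l o n x : Fin 4}
    (hex : ∀ i, i = k ∨ i = l ∨ i = o ∨ i = n) (hP : ∀ Q ∈ P, IsRectAt Q k l o n)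
    (hx : x = l ∨ x = n) (S : Fin 4 → Finset Pt) (hS : ∀ Q ∈ P, ∀ i, Q i ∈ S i) {K b c d : ℕ}
    (hK : 2 ≤ K) (hrich : ∀ Q ∈ P, K ≤ lineCount (lineThrough (Q k) (Q x)) (S k) ∧
      lineCount (lineThrough (Q k) (Q x)) (S k) < 2 * K)
    (hb : ∀ Q ∈ P, lineCount (lineThrough (Q l) (Q k)) (S l) ≤ b)
    (hc : ∀ Q ∈ P, lineCount (lineThrough (Q n) (Q k)) (S n) ≤ c)
    (hd : ∀ Q ∈ P, lineCount (lineThrough (Q o) (Q l)) (S o) ≤ d) :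
    (P.card : ℝ) * K ^ 2 ≤ c * b * (2 * (576 * ((S k).card : ℝ) ^ 2 + 12 * (S k).card * K ^ 2)) ∧
    (P.card : ℝ) * K ^ 2 ≤ d * b * (2 * (576 * ((S k).card : ℝ) ^ 2 + 12 * (S k).card * K ^ 2)) := by
  classical
  set F : Quad → Pt × Set (ℝ × ℝ) := fun Q => (Q k, lineThrough (Q k) (Q x)) with hF
  have hkx : ∀ Q ∈ P, Q k ≠ Q x := by
    intro Q hQ
    rcases hx with rfl | rfl
    exacts [(hP Q hQ).ne_left, (hP Q hQ).ne_right]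
  have hI := card_rich_incidences (S k) (P.image F) K hK fun i hi => by
    obtain ⟨Q, hQ, rfl⟩ := Finset.mem_image.1 hi
    exact ⟨hS Q hQ k, isLine_lineThrough (hkx Q hQ), left_mem_lineThrough _ _, hrich Q hQ⟩
  have hext : ∀ Q Q' : Quad, Q k = Q' k → Q l = Q' l → Q o = Q' o → Q n = Q' n → Q = Q' := by
    intro Q Q' h1 h2 h3 h4
    funext i
    rcases hex i with rfl | rfl | rfl | rfl <;> assumption
  have h1 : P.card ≤ c * (b * (P.image F).card) := by
    refine card_le_two_step P F (fun Q => Q l) (fun Q => Q k) (fun Q => Q n) (fun Q => Q k) (S l)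
      (S n) b c (fun Q hQ => hS Q hQ l) hb ?_ (fun Q hQ => hS Q hQ n) hc ?_ ?_
    · intro Q hQ Q' hQ' h
      obtain ⟨h1, h2⟩ := Prod.ext_iff.1 h
      exact ((hP Q hQ).mem_lineThrough (hP Q' hQ') hx h1 h2).1
    · intro Q hQ Q' hQ' h _
      obtain ⟨h1, h2⟩ := Prod.ext_iff.1 h
      exact ((hP Q hQ).mem_lineThrough (hP Q' hQ') hx h1 h2).2
    · intro Q hQ Q' hQ' h hl hn
      obtain ⟨h1, h2⟩ := Prod.ext_iff.1 h
      have h1 : Q k = Q' k := h1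
      have hl : Q l = Q' l := hl
      have hn : Q n = Q' n := hn
      refine hext Q Q' h1 hl ?_ hn
      have := (hP Q hQ).para
      rw [h1, hl, hn, ← (hP Q' hQ').para] at this
      exact add_left_cancel this
  have h2 : P.card ≤ d * (b * (P.image F).card) := by
    refine card_le_two_step P F (fun Q => Q l) (fun Q => Q k) (fun Q => Q o) (fun Q => Q l) (S l)
      (S o) b d (fun Q hQ => hS Q hQ l) hb ?_ (fun Q hQ => hS Q hQ o) hd ?_ ?_
    · intro Q hQ Q' hQ' h
      obtain ⟨h1, h2⟩ := Prod.ext_iff.1 h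
      exact ((hP Q hQ).mem_lineThrough (hP Q' hQ') hx h1 h2).1
    · intro Q hQ Q' hQ' h hl
      obtain ⟨h1, h2⟩ := Prod.ext_iff.1 h
      exact (hP Q hQ).opposite_mem (hP Q' hQ') h1 hl
        ((hP Q hQ).mem_lineThrough (hP Q' hQ') hx h1 h2).2
    · intro Q hQ Q' hQ' h hl ho
      obtain ⟨h1, h2⟩ := Prod.ext_iff.1 h
      have h1 : Q k = Q' k := h1
      have hl : Q l = Q' l := hl
      have ho : Q o = Q' o := ho
      refine hext Q Q' h1 hl ho ?_
      have := (hP Q hQ).para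
      rw [h1, hl, ho, (hP Q' hQ').para] at this
      exact (add_left_cancel this).symm
  have key : ∀ e : ℕ, P.card ≤ e * (b * (P.image F).card) → (P.card : ℝ) * K ^ 2 ≤
      e * b * (2 * (576 * ((S k).card : ℝ) ^ 2 + 12 * (S k).card * K ^ 2)) := by
    intro e he
    have he' : (P.card : ℝ) ≤ e * (b * (P.image F).card) := by exact_mod_cast he
    calc (P.card : ℝ) * K ^ 2 ≤ e * (b * (P.image F).card) * K ^ 2 := by gcongr
      _ = e * b * ((P.image F).card * (K : ℝ) ^ 2) := by ring
      _ ≤ _ := by gcongr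
  exact ⟨key c h1, key d h2⟩

/-- Counting rectangles by the cross at the vertex `k`. -/
lemma card_rect_le {P : Finset Quad} {k l o n : Fin 4}
    (hex : ∀ i, i = k ∨ i = l ∨ i = o ∨ i = n) (hP : ∀ Q ∈ P, IsRectAt Q k l o n)
    (S : Fin 4 → Finset Pt) (hS : ∀ Q ∈ P, ∀ i, Q i ∈ S i) {K b c d : ℕ}
    (hK : 2 ≤ K) (hrich : ∀ Q ∈ P, K ≤ max (lineCount (lineThrough (Q k) (Q l)) (S k))
      (lineCount (lineThrough (Q k) (Q n)) (S k)) ∧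
      max (lineCount (lineThrough (Q k) (Q l)) (S k))
      (lineCount (lineThrough (Q k) (Q n)) (S k)) < 2 * K)
    (hb : ∀ Q ∈ P, lineCount (lineThrough (Q l) (Q k)) (S l) ≤ b)
    (hc : ∀ Q ∈ P, lineCount (lineThrough (Q n) (Q k)) (S n) ≤ c)
    (hd : ∀ Q ∈ P, lineCount (lineThrough (Q o) (Q l)) (S o) ≤ d) :
    (P.card : ℝ) * K ^ 2 ≤ c * b * (4 * (576 * ((S k).card : ℝ) ^ 2 + 12 * (S k).card * K ^ 2)) ∧
    (P.card : ℝ) * K ^ 2 ≤ d * b * (4 * (576 * ((S k).card : ℝ) ^ 2 + 12 * (S k).card * K ^ 2)) := by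
  classical
  set p : Quad → Prop := fun Q => K ≤ lineCount (lineThrough (Q k) (Q l)) (S k) with hp
  have hcard := Finset.card_filter_add_card_filter_not (s := P) p
  have h1 := card_rect_le_of_rich_side (P := P.filter p) (x := l) hex
    (fun Q hQ => hP Q (Finset.mem_filter.1 hQ).1) (Or.inl rfl) S
    (fun Q hQ => hS Q (Finset.mem_filter.1 hQ).1) hK
    (fun Q hQ => ⟨(Finset.mem_filter.1 hQ).2,
      (max_lt_iff.1 (hrich Q (Finset.mem_filter.1 hQ).1).2).1⟩)
    (fun Q hQ => hb Q (Finset.mem_filter.1 hQ).1) (fun Q hQ => hc Q (Finset.mem_filter.1 hQ).1)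
    (fun Q hQ => hd Q (Finset.mem_filter.1 hQ).1)
  have h2 := card_rect_le_of_rich_side (P := P.filter fun Q => ¬ p Q) (x := n) hex
    (fun Q hQ => hP Q (Finset.mem_filter.1 hQ).1) (Or.inr rfl) S
    (fun Q hQ => hS Q (Finset.mem_filter.1 hQ).1) hK
    (fun Q hQ => ⟨(le_max_iff.1 (hrich Q (Finset.mem_filter.1 hQ).1).1).resolve_left
      (Finset.mem_filter.1 hQ).2, (max_lt_iff.1 (hrich Q (Finset.mem_filter.1 hQ).1).2).2⟩)
    (fun Q hQ => hb Q (Finset.mem_filter.1 hQ).1) (fun Q hQ => hc Q (Finset.mem_filter.1 hQ).1)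
    (fun Q hQ => hd Q (Finset.mem_filter.1 hQ).1)
  have hcard' : (P.card : ℝ) = (P.filter p).card + (P.filter fun Q => ¬ p Q).card := by
    exact_mod_cast hcard.symm
  rw [hcard', add_mul]
  constructor <;> linarith [h1.1, h1.2, h2.1, h2.2]

lemma isRectAt_of_mem_QZeroJA {S : ℕ → Finset Pt} {j a : Fin 4 → ℕ} {Q : Quad}
    (hQ : Q ∈ QZeroJA S j a) (k : Fin 4) :
    IsRectAt Q k (k + 1) (k + 2) (k + 3) ∧ IsRectAt Q k (k + 3) (k + 2) (k + 1) := by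
  obtain ⟨⟨hpara, hdot⟩, hinj, -⟩ := hQ
  have h1 : (Q 0).1 + (Q 2).1 = (Q 1).1 + (Q 3).1 := congrArg Prod.fst hpara
  have h2 : (Q 0).2 + (Q 2).2 = (Q 1).2 + (Q 3).2 := congrArg Prod.snd hpara
  have hpara' : Q 2 + Q 0 = Q 1 + Q 3 := by rw [← hpara, add_comm]
  have ho : Q k + Q (k + 2) = Q (k + 1) + Q (k + 3) ∧
      (Q (k + 1) - Q k).1 * (Q (k + 3) - Q k).1 + (Q (k + 1) - Q k).2 * (Q (k + 3) - Q k).2 = 0 := by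
    unfold dotQ at hdot
    have e2 : (Q 2).1 = (Q 1).1 + (Q 3).1 - (Q 0).1 := by linarith
    have e3 : (Q 2).2 = (Q 1).2 + (Q 3).2 - (Q 0).2 := by linarith
    fin_cases k <;> simp only [Prod.fst_sub, Prod.snd_sub] <;> refine ⟨?_, ?_⟩ <;>
      first
      | (change Q 0 + Q 2 = Q 1 + Q 3; exact hpara)
      | (change Q 1 + Q 3 = Q 2 + Q 0; exact hpara'.symm)
      | (change Q 2 + Q 0 = Q 3 + Q 1; rw [hpara', add_comm])
      | (change Q 3 + Q 1 = Q 0 + Q 2; rw [hpara, add_comm])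
      | (change ((Q 1).1 - (Q 0).1) * ((Q 3).1 - (Q 0).1) +
          ((Q 1).2 - (Q 0).2) * ((Q 3).2 - (Q 0).2) = 0; linear_combination hdot)
      | (change ((Q 2).1 - (Q 1).1) * ((Q 0).1 - (Q 1).1) +
          ((Q 2).2 - (Q 1).2) * ((Q 0).2 - (Q 1).2) = 0; rw [e2, e3]; linear_combination -hdot)
      | (change ((Q 3).1 - (Q 2).1) * ((Q 1).1 - (Q 2).1) +
          ((Q 3).2 - (Q 2).2) * ((Q 1).2 - (Q 2).2) = 0; rw [e2, e3]; linear_combination hdot)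
      | (change ((Q 0).1 - (Q 3).1) * ((Q 2).1 - (Q 3).1) +
          ((Q 0).2 - (Q 3).2) * ((Q 2).2 - (Q 3).2) = 0; rw [e2, e3]; linear_combination -hdot)
  have hne1 : Q k ≠ Q (k + 1) := hinj.ne (by clear * - k; revert k; decide)
  have hne3 : Q k ≠ Q (k + 3) := hinj.ne (by clear * - k; revert k; decide)
  exact ⟨⟨ho.1, ho.2, hne1, hne3⟩, ⟨by rw [ho.1, add_comm], by linear_combination ho.2, hne3, hne1⟩⟩

/-- The bounds for the number of rectangles obtained by starting at the vertex `k` and then choosing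
two more vertices. -/
lemma card_QZeroJA_le {S : ℕ → Finset Pt} {j a : Fin 4 → ℕ} {C : ℕ} {P : Finset Quad}
    (hP : ∀ Q ∈ P, Q ∈ QZeroJA S j a) (hS : ∀ k, (S (j k)).card ≤ 2 ^ j k) (k : Fin 4)
    (ha : 1 ≤ a k) (haj : 2 * a k ≤ j k + 2 * C) :
    (P.card : ℝ) * 4 ^ a k ≤ 9408 * 4 ^ C * 4 ^ j k * 2 ^ (a (k + 1) + a (k + 3)) ∧
    (P.card : ℝ) * 4 ^ a k ≤ 9408 * 4 ^ C * 4 ^ j k * 2 ^ (a (k + 1) + a (k + 2)) ∧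
    (P.card : ℝ) * 4 ^ a k ≤ 9408 * 4 ^ C * 4 ^ j k * 2 ^ (a (k + 3) + a (k + 2)) := by
  have hcnt : ∀ Q ∈ P, ∀ i, lineCount (lineThrough (Q i) (Q (i + 1))) (S (j i)) ≤ 2 ^ (a i + 1) ∧
      lineCount (lineThrough (Q i) (Q (i + 3))) (S (j i)) ≤ 2 ^ (a i + 1) := by
    intro Q hQ i
    have h := max_lt_iff.1 ((hP Q hQ).2.2.2 i).2
    rw [show i - 1 = i + 3 by clear * - i; revert i; decide] at h
    exact ⟨h.1.le, h.2.le⟩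
  have hrich : ∀ Q ∈ P, 2 ^ a k ≤ max (lineCount (lineThrough (Q k) (Q (k + 1))) (S (j k)))
      (lineCount (lineThrough (Q k) (Q (k + 3))) (S (j k))) ∧
      max (lineCount (lineThrough (Q k) (Q (k + 1))) (S (j k)))
      (lineCount (lineThrough (Q k) (Q (k + 3))) (S (j k))) < 2 * 2 ^ a k := by
    intro Q hQ
    have h := (hP Q hQ).2.2.2 k
    rw [show k - 1 = k + 3 by clear * - k; revert k; decide, pow_succ, mul_comm _ 2] at h
    exact h
  have hmem : ∀ Q ∈ P, ∀ i, Q i ∈ S (j i) := fun Q hQ => (hP Q hQ).2.2.1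
  have h2a : 2 ≤ 2 ^ a k := by
    calc 2 = 2 ^ 1 := rfl
      _ ≤ 2 ^ a k := Nat.pow_le_pow_right (by norm_num) ha
  have i1 : k + 1 + 3 = k := by clear * - k; revert k; decide
  have i2 : k + 3 + 1 = k := by clear * - k; revert k; decide
  have i3 : k + 2 + 3 = k + 1 := by clear * - k; revert k; decide
  have i4 : k + 2 + 1 = k + 3 := by clear * - k; revert k; decide
  have A := card_rect_le (P := P) (k := k) (l := k + 1) (o := k + 2) (n := k + 3)
    (by clear * - k; revert k; decide) (fun Q hQ => (isRectAt_of_mem_QZeroJA (hP Q hQ) k).1) (fun i => S (j i))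
    hmem h2a hrich (b := 2 ^ (a (k + 1) + 1)) (c := 2 ^ (a (k + 3) + 1))
    (d := 2 ^ (a (k + 2) + 1))
    (fun Q hQ => by have := (hcnt Q hQ (k + 1)).2; rwa [i1] at this)
    (fun Q hQ => by have := (hcnt Q hQ (k + 3)).1; rwa [i2] at this)
    (fun Q hQ => by have := (hcnt Q hQ (k + 2)).2; rwa [i3] at this)
  have B := card_rect_le (P := P) (k := k) (l := k + 3) (o := k + 2) (n := k + 1)
    (by clear * - k; revert k; decide) (fun Q hQ => (isRectAt_of_mem_QZeroJA (hP Q hQ) k).2) (fun i => S (j i))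
    hmem h2a (by simpa only [max_comm] using hrich) (b := 2 ^ (a (k + 3) + 1))
    (c := 2 ^ (a (k + 1) + 1)) (d := 2 ^ (a (k + 2) + 1))
    (fun Q hQ => by have := (hcnt Q hQ (k + 3)).1; rwa [i2] at this)
    (fun Q hQ => by have := (hcnt Q hQ (k + 1)).2; rwa [i1] at this)
    (fun Q hQ => by have := (hcnt Q hQ (k + 2)).1; rwa [i4] at this)
  have hSr : ((S (j k)).card : ℝ) ≤ 2 ^ j k := by exact_mod_cast hS k
  have hsq : ∀ n : ℕ, ((2 : ℝ) ^ n) ^ 2 = 4 ^ n := fun n => by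
    rw [← pow_mul, mul_comm, pow_mul]; norm_num
  have ha4 : (4 : ℝ) ^ a k ≤ 4 ^ C * 2 ^ j k := by
    rw [← hsq, ← hsq, ← pow_mul, ← pow_mul, ← pow_add]
    exact pow_le_pow_right₀ (by norm_num) (by omega)
  have hC : (1 : ℝ) ≤ 4 ^ C := one_le_pow₀ (by norm_num)
  have hbase : 576 * ((S (j k)).card : ℝ) ^ 2 + 12 * (S (j k)).card * 4 ^ a k ≤
      588 * 4 ^ C * 4 ^ j k := by
    calc 576 * ((S (j k)).card : ℝ) ^ 2 + 12 * (S (j k)).card * 4 ^ a k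
        ≤ 576 * ((2 : ℝ) ^ j k) ^ 2 + 12 * 2 ^ j k * (4 ^ C * 2 ^ j k) := by gcongr
      _ = 576 * 4 ^ j k * 1 + 12 * 4 ^ C * 4 ^ j k := by rw [← hsq (j k)]; ring
      _ ≤ 576 * 4 ^ j k * 4 ^ C + 12 * 4 ^ C * 4 ^ j k := by gcongr
      _ = _ := by ring
  have fin : ∀ u v : ℕ, ((2 ^ (v + 1) : ℕ) : ℝ) * ((2 ^ (u + 1) : ℕ) : ℝ) *
      (4 * (576 * ((S (j k)).card : ℝ) ^ 2 + 12 * (S (j k)).card * 4 ^ a k)) ≤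
      9408 * 4 ^ C * 4 ^ j k * 2 ^ (u + v) := by
    intro u v
    push_cast
    calc (2 : ℝ) ^ (v + 1) * 2 ^ (u + 1) *
        (4 * (576 * ((S (j k)).card : ℝ) ^ 2 + 12 * (S (j k)).card * 4 ^ a k))
        ≤ 2 ^ (v + 1) * 2 ^ (u + 1) * (4 * (588 * 4 ^ C * 4 ^ j k)) := by gcongr
      _ = _ := by ring
  have hK : (((2 ^ a k : ℕ) : ℝ)) ^ 2 = 4 ^ a k := by push_cast; exact hsq _
  rw [hK] at A B
  exact ⟨A.1.trans (fin _ _), A.2.trans (fin _ _), B.2.trans (fin _ _)⟩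

/-- The common ratio of the geometric decay in the differences of the indices. -/
def decayRatio : ℝ := (2 : ℝ) ^ (-(1 / 108) : ℝ)

lemma decayRatio_pos : 0 < decayRatio := Real.rpow_pos_of_pos two_pos _

lemma decayRatio_lt_one : decayRatio < 1 :=
  Real.rpow_lt_one_of_one_lt_of_neg one_lt_two (by norm_num)

/-- Geometric decay in the distance of two indices. -/
def decay (i j : ℕ) : ℝ := decayRatio ^ ((i : ℤ) - j).natAbs

lemma decay_nonneg (i j : ℕ) : 0 ≤ decay i j := pow_nonneg decayRatio_pos.le _

lemma decay_comm (i j : ℕ) : decay i j = decay j i := by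
  unfold decay
  congr 1
  omega

lemma decay_eq_rpow (i j : ℕ) : decay i j = (2 : ℝ) ^ (-(1 / 108) * |(i : ℝ) - j| : ℝ) := by
  rw [decay, decayRatio, Real.rpow_mul zero_le_two, ← Real.rpow_natCast, Nat.cast_natAbs]
  push_cast
  rfl

lemma sum_decayRatio_pow_le (s : Finset ℕ) (g : ℕ → ℕ) (hg : Set.InjOn g s) :
    ∑ j ∈ s, decayRatio ^ g j ≤ (1 - decayRatio)⁻¹ := by
  rw [← Finset.sum_image (f := fun t => decayRatio ^ t) hg,
    ← tsum_geometric_of_lt_one decayRatio_pos.le decayRatio_lt_one]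
  exact (summable_geometric_of_lt_one decayRatio_pos.le decayRatio_lt_one).sum_le_tsum _
    fun _ _ => pow_nonneg decayRatio_pos.le _

/-- A bound for the sum of `decay i j` over `j`. -/
def decaySum : ℝ := 2 * (1 - decayRatio)⁻¹

lemma decaySum_pos : 0 < decaySum :=
  mul_pos two_pos (inv_pos.2 (sub_pos.2 decayRatio_lt_one))

lemma sum_decay_le (s : Finset ℕ) (i : ℕ) : ∑ j ∈ s, decay i j ≤ decaySum := by
  rw [← Finset.sum_filter_add_sum_filter_not s (fun j => j ≤ i), decaySum, two_mul]
  refine add_le_add (sum_decayRatio_pow_le _ _ ?_) (sum_decayRatio_pow_le _ _ ?_)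
  · intro x hx y hy h
    simp only [Finset.coe_filter, Set.mem_ofPred_eq] at hx hy h
    omega
  · intro x hx y hy h
    simp only [Finset.coe_filter, Set.mem_ofPred_eq] at hx hy h
    omega

lemma exponent_le {x j0 j1 j2 j3 a0 a1 a2 a3 : ℝ}
    (h01 : x ≤ 2 * j0 - 2 * a0 + a1 + a3) (h02 : x ≤ 2 * j0 - 2 * a0 + a1 + a2)
    (h11 : x ≤ 2 * j1 - 2 * a1 + a2 + a0) (h12 : x ≤ 2 * j1 - 2 * a1 + a2 + a3)
    (h13 : x ≤ 2 * j1 - 2 * a1 + a0 + a3)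
    (h21 : x ≤ 2 * j2 - 2 * a2 + a3 + a1) (h22 : x ≤ 2 * j2 - 2 * a2 + a3 + a0)
    (h23 : x ≤ 2 * j2 - 2 * a2 + a1 + a0)
    (h31 : x ≤ 2 * j3 - 2 * a3 + a0 + a2) (h32 : x ≤ 2 * j3 - 2 * a3 + a0 + a1) :
    x ≤ (j0 + j1 + j2 + j3) / 2 + -(1 / 108) * (|j0 - j1| + |j0 - j2| + |j0 - j3| +
      |a0 - a1| + |a0 - a2| + |a0 - a3|) := by
  have b1 : |j0 - j1| ≤ -18 * (x - (j0 + j1 + j2 + j3) / 2) := abs_le.2 ⟨by linarith, by linarith⟩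
  have b2 : |j0 - j2| ≤ -18 * (x - (j0 + j1 + j2 + j3) / 2) := abs_le.2 ⟨by linarith, by linarith⟩
  have b3 : |j0 - j3| ≤ -18 * (x - (j0 + j1 + j2 + j3) / 2) := abs_le.2 ⟨by linarith, by linarith⟩
  have c1 : |a0 - a1| ≤ -18 * (x - (j0 + j1 + j2 + j3) / 2) := abs_le.2 ⟨by linarith, by linarith⟩
  have c2 : |a0 - a2| ≤ -18 * (x - (j0 + j1 + j2 + j3) / 2) := abs_le.2 ⟨by linarith, by linarith⟩
  have c3 : |a0 - a3| ≤ -18 * (x - (j0 + j1 + j2 + j3) / 2) := abs_le.2 ⟨by linarith, by linarith⟩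
  linarith

/-- The number of rectangles in `𝒬⁰(j⃗, a⃗)`, normalized by the sizes of the sets, decays in the
differences of the indices. -/
lemma card_QZeroJA_mul_le_decay {S : ℕ → Finset Pt} {j a : Fin 4 → ℕ} {C : ℕ} {P : Finset Quad}
    (hP : ∀ Q ∈ P, Q ∈ QZeroJA S j a) (hS : ∀ k, (S (j k)).card ≤ 2 ^ j k)
    (ha : ∀ k, 1 ≤ a k) (haj : ∀ k, 2 * a k ≤ j k + 2 * C) (hne : P.Nonempty) :
    (P.card : ℝ) * ∏ k, (2 : ℝ) ^ (-(j k : ℝ) / 2) ≤ 9408 * 4 ^ C *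
      (decay (j 0) (j 1) * decay (j 0) (j 2) * decay (j 0) (j 3) *
        (decay (a 0) (a 1) * decay (a 0) (a 2) * decay (a 0) (a 3))) := by
  have hK : (0 : ℝ) < 9408 * 4 ^ C := by positivity
  have hN : (0 : ℝ) < P.card := by exact_mod_cast hne.card_pos
  have h2 : (0 : ℝ) < 2 := two_pos
  obtain ⟨x, hx⟩ : ∃ x : ℝ, (P.card : ℝ) = 9408 * 4 ^ C * 2 ^ x := by
    refine ⟨Real.logb 2 (P.card / (9408 * 4 ^ C)), ?_⟩
    rw [Real.rpow_logb h2 (by norm_num) (by positivity)]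
    field_simp
  have key : ∀ p q u v : ℕ, (P.card : ℝ) * 4 ^ p ≤ 9408 * 4 ^ C * 4 ^ q * 2 ^ (u + v) →
      x ≤ 2 * q - 2 * p + u + v := by
    intro p q u v h
    have h4 : ∀ n : ℕ, (4 : ℝ) ^ n = 2 ^ (2 * n : ℝ) := fun n => by
      rw [Real.rpow_mul h2.le, Real.rpow_natCast]; norm_num
    rw [hx, mul_assoc, mul_assoc (9408 * 4 ^ C : ℝ)] at h
    have h := le_of_mul_le_mul_left h hK
    rw [h4, h4, ← Real.rpow_natCast 2 (u + v), ← Real.rpow_add h2, ← Real.rpow_add h2,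
      Real.rpow_le_rpow_left_iff one_lt_two] at h
    push_cast at h
    linarith
  have H := fun k => card_QZeroJA_le hP hS k (ha k) (haj k)
  have hexp := exponent_le (key _ _ _ _ (H 0).1) (key _ _ _ _ (H 0).2.1)
    (key _ _ _ _ (H 1).1) (key _ _ _ _ (H 1).2.1) (key _ _ _ _ (H 1).2.2)
    (key _ _ _ _ (H 2).1) (key _ _ _ _ (H 2).2.1) (key _ _ _ _ (H 2).2.2)
    (key _ _ _ _ (H 3).1) (key _ _ _ _ (H 3).2.1)
  simp only [decay_eq_rpow, Fin.prod_univ_four, hx, mul_assoc, ← Real.rpow_add h2]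
  refine mul_le_mul_of_nonneg_left (mul_le_mul_of_nonneg_left
    (Real.rpow_le_rpow_of_exponent_le one_le_two ?_) (by positivity)) (by positivity)
  simp only [zero_add] at hexp
  linarith

lemma sum_decay_mul_decay_mul_decay_le (s : Finset ℕ) (i : ℕ) :
    ∑ x ∈ s, ∑ y ∈ s, ∑ z ∈ s, decay i x * decay i y * decay i z ≤ decaySum ^ 3 := by
  have h0 : 0 ≤ ∑ x ∈ s, decay i x := Finset.sum_nonneg fun _ _ => decay_nonneg _ _
  calc ∑ x ∈ s, ∑ y ∈ s, ∑ z ∈ s, decay i x * decay i y * decay i z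
      = (∑ x ∈ s, decay i x) ^ 3 := by
        simp only [← Finset.mul_sum, ← Finset.sum_mul]; ring
    _ ≤ _ := pow_le_pow_left₀ h0 (sum_decay_le s i) 3

lemma sum_quadruple_decay_le (s : Finset ℕ) (lam : ℕ → ℝ) (hlam : ∀ j ∈ s, 0 ≤ lam j) :
    ∑ j0 ∈ s, ∑ j1 ∈ s, ∑ j2 ∈ s, ∑ j3 ∈ s, lam j0 * lam j1 * (lam j2 * lam j3) *
      (decay j0 j1 * decay j0 j2 * decay j0 j3) ≤ decaySum ^ 3 * (∑ j ∈ s, lam j ^ 2) ^ 2 := by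
  set L : ℝ := ∑ j ∈ s, lam j ^ 2 with hL
  have hL0 : 0 ≤ L := Finset.sum_nonneg fun _ _ => sq_nonneg _
  have hR := decaySum_pos
  have hle : ∀ j ∈ s, lam j ^ 2 ≤ L := fun j hj =>
    Finset.single_le_sum (f := fun j => lam j ^ 2) (fun _ _ => sq_nonneg _) hj
  have hinner : ∀ j0 ∈ s, ∀ j1 ∈ s, ∑ j2 ∈ s, ∑ j3 ∈ s, lam j0 * lam j1 * (lam j2 * lam j3) *
      (decay j0 j1 * decay j0 j2 * decay j0 j3) ≤
      (lam j0 ^ 2 + lam j1 ^ 2) / 2 * L * decaySum ^ 2 * decay j0 j1 := by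
    intro j0 h0 j1 h1
    calc ∑ j2 ∈ s, ∑ j3 ∈ s, lam j0 * lam j1 * (lam j2 * lam j3) *
          (decay j0 j1 * decay j0 j2 * decay j0 j3)
        ≤ ∑ j2 ∈ s, ∑ j3 ∈ s, (lam j0 ^ 2 + lam j1 ^ 2) / 2 * L *
          (decay j0 j1 * decay j0 j2 * decay j0 j3) := by
          refine Finset.sum_le_sum fun j2 h2 => Finset.sum_le_sum fun j3 h3 => ?_
          refine mul_le_mul_of_nonneg_right ?_ (mul_nonneg (mul_nonneg (decay_nonneg _ _)
            (decay_nonneg _ _)) (decay_nonneg _ _))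
          refine mul_le_mul ?_ ?_ (mul_nonneg (hlam _ h2) (hlam _ h3)) (by positivity)
          · linarith [two_mul_le_add_sq (lam j0) (lam j1)]
          · linarith [two_mul_le_add_sq (lam j2) (lam j3), hle j2 h2, hle j3 h3]
      _ = (lam j0 ^ 2 + lam j1 ^ 2) / 2 * L * decay j0 j1 * (∑ j ∈ s, decay j0 j) ^ 2 := by
          simp only [← Finset.mul_sum, ← Finset.sum_mul]; ring
      _ ≤ (lam j0 ^ 2 + lam j1 ^ 2) / 2 * L * decay j0 j1 * decaySum ^ 2 :=
          mul_le_mul_of_nonneg_left (pow_le_pow_left₀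
            (Finset.sum_nonneg fun _ _ => decay_nonneg _ _) (sum_decay_le s j0) 2)
            (mul_nonneg (by positivity) (decay_nonneg _ _))
      _ = _ := by ring
  have hrow : ∑ i ∈ s, ∑ j ∈ s, lam i ^ 2 * decay i j ≤ L * decaySum := by
    rw [hL, Finset.sum_mul]
    refine Finset.sum_le_sum fun i _ => ?_
    rw [← Finset.mul_sum]
    exact mul_le_mul_of_nonneg_left (sum_decay_le s i) (sq_nonneg _)
  have hcol : ∑ i ∈ s, ∑ j ∈ s, lam j ^ 2 * decay i j ≤ L * decaySum := by
    rw [Finset.sum_comm]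
    simpa only [decay_comm] using hrow
  calc _ ≤ ∑ j0 ∈ s, ∑ j1 ∈ s,
        (lam j0 ^ 2 + lam j1 ^ 2) / 2 * L * decaySum ^ 2 * decay j0 j1 :=
        Finset.sum_le_sum fun j0 h0 => Finset.sum_le_sum fun j1 h1 => hinner j0 h0 j1 h1
    _ = L * decaySum ^ 2 / 2 * (∑ i ∈ s, ∑ j ∈ s, lam i ^ 2 * decay i j +
        ∑ i ∈ s, ∑ j ∈ s, lam j ^ 2 * decay i j) := by
        simp only [← Finset.sum_add_distrib, Finset.mul_sum]
        refine Finset.sum_congr rfl fun _ _ => Finset.sum_congr rfl fun _ _ => by ring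
    _ ≤ L * decaySum ^ 2 / 2 * (L * decaySum + L * decaySum) := by gcongr
    _ = _ := by ring

/-- The weight of a class of rectangles in the final summation. -/
def classWeight (C : ℕ) (lam : ℕ → ℝ) (p : (ℕ × ℕ × ℕ × ℕ) × (ℕ × ℕ × ℕ × ℕ)) : ℝ :=
  9408 * 4 ^ C * ((lam p.1.1 * lam p.1.2.1 * (lam p.1.2.2.1 * lam p.1.2.2.2) *
    (decay p.1.1 p.1.2.1 * decay p.1.1 p.1.2.2.1 * decay p.1.1 p.1.2.2.2)) *
    (decay p.2.1 p.2.2.1 * decay p.2.1 p.2.2.2.1 * decay p.2.1 p.2.2.2.2))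

lemma sum_classWeight_le (C : ℕ) (s t : Finset ℕ) (lam : ℕ → ℝ) (hlam : ∀ j ∈ s, 0 ≤ lam j) :
    ∑ p ∈ (s ×ˢ s ×ˢ s ×ˢ s) ×ˢ (t ×ˢ t ×ˢ t ×ˢ t), classWeight C lam p ≤
      9408 * 4 ^ C * decaySum ^ 6 * t.card * (∑ j ∈ s, lam j ^ 2) ^ 2 := by
  have hR := decaySum_pos
  have hj : ∑ p ∈ s ×ˢ s ×ˢ s ×ˢ s, lam p.1 * lam p.2.1 * (lam p.2.2.1 * lam p.2.2.2) *
      (decay p.1 p.2.1 * decay p.1 p.2.2.1 * decay p.1 p.2.2.2) ≤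
      decaySum ^ 3 * (∑ j ∈ s, lam j ^ 2) ^ 2 := by
    simp only [Finset.sum_product]
    exact sum_quadruple_decay_le s lam hlam
  have ha : ∑ p ∈ t ×ˢ t ×ˢ t ×ˢ t, decay p.1 p.2.1 * decay p.1 p.2.2.1 * decay p.1 p.2.2.2 ≤
      t.card * decaySum ^ 3 := by
    simp only [Finset.sum_product]
    rw [← nsmul_eq_mul]
    exact Finset.sum_le_card_nsmul _ _ _ fun i _ => sum_decay_mul_decay_mul_decay_le t i
  have ha0 : 0 ≤ ∑ p ∈ t ×ˢ t ×ˢ t ×ˢ t,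
      decay p.1 p.2.1 * decay p.1 p.2.2.1 * decay p.1 p.2.2.2 :=
    Finset.sum_nonneg fun _ _ => mul_nonneg (mul_nonneg (decay_nonneg _ _) (decay_nonneg _ _))
      (decay_nonneg _ _)
  simp only [classWeight]
  rw [← Finset.mul_sum, Finset.sum_product]
  simp only [← Finset.mul_sum, ← Finset.sum_mul]
  calc _ ≤ 9408 * 4 ^ C * ((decaySum ^ 3 * (∑ j ∈ s, lam j ^ 2) ^ 2) *
        (t.card * decaySum ^ 3)) := by gcongr
    _ = _ := by ring

lemma fWt_eq {S : ℕ → Finset Pt} {lam : ℕ → ℝ} {m j : ℕ} {ξ : Pt}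
    (hdisj : ∀ i ≤ m, ∀ j ≤ m, i ≠ j → Disjoint (S i) (S j)) (hj : j ≤ m) (hξ : ξ ∈ S j) :
    fWt S lam m ξ = lam j * (2 : ℝ) ^ (-(j : ℝ) / 2) := by
  rw [fWt, Finset.sum_eq_single_of_mem j (Finset.mem_range.2 (by omega)), if_pos hξ]
  intro i hi hij
  exact if_neg fun h => Finset.disjoint_left.1
    (hdisj i (Nat.lt_succ_iff.1 (Finset.mem_range.1 hi)) j hj hij) h hξ

lemma exists_mem_QZeroJA {S : ℕ → Finset Pt} {C m : ℕ} {Q : Quad} (hQ : Q ∈ QZeroAB S C m 2 2) :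
    ∃ j a : Fin 4 → ℕ, (∀ k, j k ≤ m) ∧ (∀ k, 1 ≤ a k) ∧ (∀ k, 2 * a k ≤ j k + 2 * C) ∧
      Q ∈ QZeroJA S j a := by
  obtain ⟨hrect, hinj, h0, h1, h2, h3⟩ := hQ
  have hv : ∀ k : Fin 4, VertexType S C m 2 (Q k) (Q (k + 1)) (Q (k - 1)) := by
    intro k
    fin_cases k
    exacts [h0, h1, h2, h3]
  have hex : ∀ k : Fin 4, ∃ j a : ℕ, j ≤ m ∧ 1 ≤ a ∧ 2 * a ≤ j + 2 * C ∧ Q k ∈ S j ∧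
      2 ^ a ≤ crossMax S j (Q k) (Q (k + 1)) (Q (k - 1)) ∧
      crossMax S j (Q k) (Q (k + 1)) (Q (k - 1)) < 2 ^ (a + 1) := by
    intro k
    obtain ⟨j, hj, hmem, h⟩ := hv k
    obtain ⟨hge, hlt⟩ : 2 ≤ crossMax S j (Q k) (Q (k + 1)) (Q (k - 1)) ∧
        (crossMax S j (Q k) (Q (k + 1)) (Q (k - 1)) : ℝ) < (2 : ℝ) ^ ((j : ℝ) / 2 + (C : ℝ)) := by
      simpa using h
    set n := crossMax S j (Q k) (Q (k + 1)) (Q (k - 1))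
    have hpow : 2 ^ Nat.log 2 n ≤ n := Nat.pow_log_le_self 2 (by omega)
    refine ⟨j, Nat.log 2 n, hj, Nat.log_pos one_lt_two hge, ?_, hmem, hpow,
      Nat.lt_pow_succ_log_self one_lt_two n⟩
    have hpow' : ((2 : ℝ) ^ Nat.log 2 n) ≤ n := by exact_mod_cast hpow
    have h := hpow'.trans_lt hlt
    rw [← Real.rpow_natCast, Real.rpow_lt_rpow_left_iff one_lt_two] at h
    have : ((2 * Nat.log 2 n : ℕ) : ℝ) < ((j + 2 * C : ℕ) : ℝ) := by push_cast; linarith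
    exact_mod_cast this.le
  choose j a hj ha haj hmem hlo hhi using hex
  exact ⟨j, a, hj, ha, haj, hrect, hinj, hmem, fun k => ⟨hlo k, hhi k⟩⟩

lemma finite_QZeroAB (S : ℕ → Finset Pt) (C m α β : ℕ) : (QZeroAB S C m α β).Finite := by
  classical
  refine (Fintype.piFinset fun _ : Fin 4 =>
    (Finset.range (m + 1)).biUnion S).finite_toSet.subset fun Q hQ => ?_
  obtain ⟨-, -, ⟨j0, h0, m0, -⟩, ⟨j1, h1, m1, -⟩, ⟨j2, h2, m2, -⟩, ⟨j3, h3, m3, -⟩⟩ := hQ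
  rw [Finset.mem_coe, Fintype.mem_piFinset]
  intro k
  rw [Finset.mem_biUnion]
  fin_cases k
  exacts [⟨j0, Finset.mem_range.2 (by omega), m0⟩, ⟨j1, Finset.mem_range.2 (by omega), m1⟩,
    ⟨j2, Finset.mem_range.2 (by omega), m2⟩, ⟨j3, Finset.mem_range.2 (by omega), m3⟩]

/-- The indices of a class of rectangles as a tuple. -/
def indexTuple (j : Fin 4 → ℕ) : ℕ × ℕ × ℕ × ℕ := (j 0, j 1, j 2, j 3)

lemma indexTuple_injective : Function.Injective indexTuple := by
  intro j j' h
  simp only [indexTuple, Prod.mk.injEq] at h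
  funext k
  fin_cases k
  exacts [h.1, h.2.1, h.2.2.1, h.2.2.2]

/-- The contribution of one class of rectangles. -/
lemma sum_fQ_le_classWeight {S : ℕ → Finset Pt} {lam : ℕ → ℝ} {C m : ℕ} {j a : Fin 4 → ℕ}
    {P : Finset Quad} (hdisj : ∀ i ≤ m, ∀ j ≤ m, i ≠ j → Disjoint (S i) (S j))
    (hS : ∀ j ≤ m, (S j).card ≤ 2 ^ j) (hlam : ∀ j ≤ m, 0 ≤ lam j) (hj : ∀ k, j k ≤ m)
    (ha : ∀ k, 1 ≤ a k) (haj : ∀ k, 2 * a k ≤ j k + 2 * C) (hP : ∀ Q ∈ P, Q ∈ QZeroJA S j a)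
    (hne : P.Nonempty) :
    ∑ Q ∈ P, fQ (fWt S lam m) Q ≤ classWeight C lam (indexTuple j, indexTuple a) := by
  have hf : ∀ Q ∈ P, fQ (fWt S lam m) Q = (∏ k, lam (j k)) * ∏ k, (2 : ℝ) ^ (-(j k : ℝ) / 2) := by
    intro Q hQ
    rw [fQ, ← Finset.prod_mul_distrib]
    exact Finset.prod_congr rfl fun k _ => fWt_eq hdisj (hj k) ((hP Q hQ).2.2.1 k)
  rw [Finset.sum_congr rfl hf, Finset.sum_const, nsmul_eq_mul, mul_left_comm]
  refine (mul_le_mul_of_nonneg_left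
    (card_QZeroJA_mul_le_decay hP (fun k => hS _ (hj k)) ha haj hne)
    (Finset.prod_nonneg fun k _ => hlam _ (hj k))).trans_eq ?_
  simp only [classWeight, indexTuple, Fin.prod_univ_four]
  ring
/-- **Estimate (3.6) of Lemma 3.3.** `Σ_{Q ∈ 𝒬⁰_{2,2}} f(Q) ≲ m ‖λ‖_{ℓ²}⁴`. -/
theorem sum_QZeroAB_22_bound (C : ℕ) :
    ∃ c : ℝ, 0 < c ∧
      ∀ (m : ℕ) (S : ℕ → Finset Pt) (lam : ℕ → ℝ),
        1 ≤ m →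
        (∀ i ≤ m, ∀ j ≤ m, i ≠ j → Disjoint (S i) (S j)) →
        (∀ j ≤ m, (S j).card ≤ 2 ^ j) →
        (∀ j ≤ m, 0 ≤ lam j) →
        (∀ j ≤ m, ∀ ξ ∈ S j, ∀ ℓ₁ ℓ₂ : Set (ℝ × ℝ), IsLine ℓ₁ → IsLine ℓ₂ →
          emb ξ ∈ ℓ₁ → emb ξ ∈ ℓ₂ →
          (2 : ℝ) ^ ((j : ℝ) / 2 + (C : ℝ)) ≤ (lineCount ℓ₁ (S j) : ℝ) →
          (2 : ℝ) ^ ((j : ℝ) / 2 + (C : ℝ)) ≤ (lineCount ℓ₂ (S j) : ℝ) → ℓ₁ = ℓ₂) →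
        ∑' Q : Quad, Set.indicator (QZeroAB S C m 2 2) (fQ (fWt S lam m)) Q ≤
          c * m * (∑ j ∈ Finset.range (m + 1), lam j ^ 2) ^ 2 := by
  have hR := decaySum_pos
  refine ⟨9408 * 4 ^ C * decaySum ^ 6 * (C + 2), by positivity, ?_⟩
  intro m S lam hm hdisj hS hlam _
  have hlam' : ∀ j ∈ Finset.range (m + 1), 0 ≤ lam j := fun j hj =>
    hlam j (Nat.lt_succ_iff.1 (Finset.mem_range.1 hj))
  set T := (finite_QZeroAB S C m 2 2).toFinset with hT
  have hmemT : ∀ Q, Q ∈ T ↔ Q ∈ QZeroAB S C m 2 2 := fun Q => Set.Finite.mem_toFinset _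
  have hsum : ∑' Q : Quad, Set.indicator (QZeroAB S C m 2 2) (fQ (fWt S lam m)) Q =
      ∑ Q ∈ T, fQ (fWt S lam m) Q := by
    rw [tsum_eq_sum (s := T) fun Q hQ => Set.indicator_of_notMem (fun h => hQ ((hmemT Q).2 h)) _]
    exact Finset.sum_congr rfl fun Q hQ => Set.indicator_of_mem ((hmemT Q).1 hQ) _
  have hex : ∀ Q : Quad, ∃ j a : Fin 4 → ℕ, Q ∈ T → (∀ k, j k ≤ m) ∧ (∀ k, 1 ≤ a k) ∧
      (∀ k, 2 * a k ≤ j k + 2 * C) ∧ Q ∈ QZeroJA S j a := by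
    intro Q
    by_cases hQ : Q ∈ T
    · obtain ⟨j, a, h⟩ := exists_mem_QZeroJA ((hmemT Q).1 hQ)
      exact ⟨j, a, fun _ => h⟩
    · exact ⟨0, 0, fun h => absurd h hQ⟩
  choose j a hja using hex
  set s := Finset.range (m + 1)
  set t := Finset.range (m + C + 1) with ht
  have hmaps : ∀ Q ∈ T, (indexTuple (j Q), indexTuple (a Q)) ∈
      (s ×ˢ s ×ˢ s ×ˢ s) ×ˢ (t ×ˢ t ×ˢ t ×ˢ t) := by
    intro Q hQ
    obtain ⟨hj, -, haj, -⟩ := hja Q hQ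
    have hj' : ∀ k, j Q k ∈ s := fun k => Finset.mem_range.2 (Nat.lt_succ_iff.2 (hj k))
    have ha' : ∀ k, a Q k ∈ t := fun k => Finset.mem_range.2 (by have := hj k; have := haj k; omega)
    simp only [indexTuple, Finset.mem_product, hj', ha', and_self]
  rw [hsum, ← Finset.sum_fiberwise_of_maps_to hmaps]
  have hclass : ∀ p ∈ (s ×ˢ s ×ˢ s ×ˢ s) ×ˢ (t ×ˢ t ×ˢ t ×ˢ t),
      ∑ Q ∈ T with (indexTuple (j Q), indexTuple (a Q)) = p, fQ (fWt S lam m) Q ≤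
        classWeight C lam p := by
    intro p hp
    rcases (T.filter fun Q => (indexTuple (j Q), indexTuple (a Q)) = p).eq_empty_or_nonempty
      with he | hne
    · rw [he, Finset.sum_empty]
      simp only [Finset.mem_product] at hp
      have hd := decay_nonneg
      have h0 := hlam' _ hp.1.1
      have h1 := hlam' _ hp.1.2.1
      have h2 := hlam' _ hp.1.2.2.1
      have h3 := hlam' _ hp.1.2.2.2
      unfold classWeight
      have hd3 : ∀ u v w x y z : ℕ, 0 ≤ decay u v * decay w x * decay y z := fun u v w x y z =>
        mul_nonneg (mul_nonneg (hd _ _) (hd _ _)) (hd _ _)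
      exact mul_nonneg (by positivity) (mul_nonneg (mul_nonneg (by positivity) (hd3 _ _ _ _ _ _))
        (hd3 _ _ _ _ _ _))
    · obtain ⟨Q₀, hQ₀⟩ := id hne
      obtain ⟨hQ₀T, rfl⟩ := Finset.mem_filter.1 hQ₀
      obtain ⟨hj, ha, haj, -⟩ := hja Q₀ hQ₀T
      refine sum_fQ_le_classWeight hdisj hS hlam hj ha haj (fun Q hQ => ?_) hne
      obtain ⟨hQT, heq⟩ := Finset.mem_filter.1 hQ
      obtain ⟨h1, h2⟩ := Prod.ext_iff.1 heq
      rw [← indexTuple_injective h1, ← indexTuple_injective h2]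
      exact (hja Q hQT).2.2.2
  refine (Finset.sum_le_sum hclass).trans ((sum_classWeight_le C s t lam hlam').trans ?_)
  have hcard : (t.card : ℝ) ≤ (C + 2) * m := by
    have hm' : (1 : ℝ) ≤ m := by exact_mod_cast hm
    rw [ht, Finset.card_range]
    push_cast
    nlinarith [Nat.cast_nonneg (α := ℝ) C]
  calc 9408 * 4 ^ C * decaySum ^ 6 * (t.card : ℝ) * (∑ j ∈ s, lam j ^ 2) ^ 2
      ≤ 9408 * 4 ^ C * decaySum ^ 6 * ((C + 2) * m) * (∑ j ∈ s, lam j ^ 2) ^ 2 := by gcongr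
    _ = _ := by ring
end
end
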